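/- Quantitative Liouville-type estimate for divergence-form equations with small oscillation (Proposition 5.1). Let s ∈ (0,1), δ > 0, β ∈ (s, min{1,2s}), q ≥ 1, ε > 0, and 0 < λ ≤ Λ. Let (K(x,·))_{x∈ℝⁿ} define a divergence-form nonlocal operator L of order 2s with ellipticity constants λ, Λ, satisfying for some η ≤ δ and for all x, h ∈ ℝⁿ, ρ > 0: |σ_{−h}K(x+h,·) − K(x,·)|(B_{2ρ}(x)∖B_ρ(x)) ≤ η ρ^{−2s} and |τ⁻_x K(x,·) − τ⁺_x K(x,·)|(B_{2ρ}∖B_ρ) ≤ η ρ^{−2s}. Let u ∈ C^β(ℝⁿ) with ‖u‖_{L^∞_{2s−ε}(ℝⁿ)} < ∞ and [u]_{C^β(ℝⁿ)} ≤ 1, and let f ∈ L^q_loc(ℝⁿ) with ‖f‖_{L^q(B_{1/δ})} ≤ δ. Suppose u is a weak solution of L(u,x) = f in B_{1/δ}. Then for every ε₀ > 0 there exists δ₀ > 0, depending only on ε₀, n, s, β, q, ε, λ, Λ, such that if δ < δ₀ then ‖u − u(0)‖_{L^∞(B₁)} ≤ ε₀. -/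

import Mathlib

open MeasureTheory Metric Set
open scoped ENNReal Topology RealInnerProductSpace

noncomputable section

abbrev Euc (n : ℕ) := EuclideanSpace ℝ (Fin n)

variable {n : ℕ}

def hDeg (σ : ℝ) : ℕ := ⌈σ⌉₊ - 1

def hSemiOn (σ : ℝ) (Ω A : Set (Euc n)) (u : Euc n → ℝ) : ℝ≥0∞ :=
  ⨆ (x : A) (y : A),
    ENNReal.ofReal
      (‖iteratedFDerivWithin ℝ (hDeg σ) u Ω ↑x - iteratedFDerivWithin ℝ (hDeg σ) u Ω ↑y‖ /
        ‖(x : Euc n) - (y : Euc n)‖ ^ (σ - (hDeg σ : ℝ)))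

def hSemi (σ : ℝ) (Ω : Set (Euc n)) (u : Euc n → ℝ) : ℝ≥0∞ := hSemiOn σ Ω Ω u

def hNormOn (σ : ℝ) (Ω A : Set (Euc n)) (u : Euc n → ℝ) : ℝ≥0∞ :=
  (∑ j ∈ Finset.range (hDeg σ + 1), ⨆ x : A, ENNReal.ofReal ‖iteratedFDerivWithin ℝ j u Ω ↑x‖) +
    hSemiOn σ Ω A u

def hNorm (σ : ℝ) (Ω : Set (Euc n)) (u : Euc n → ℝ) : ℝ≥0∞ := hNormOn σ Ω Ω u

def HolderMem (σ : ℝ) (Ω : Set (Euc n)) (u : Euc n → ℝ) : Prop :=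
  ContDiffOn ℝ (hDeg σ) u Ω ∧ hNorm σ Ω u ≠ ⊤

def HolderMemLoc (σ : ℝ) (Ω : Set (Euc n)) (u : Euc n → ℝ) : Prop :=
  ContDiffOn ℝ (hDeg σ) u Ω ∧
    ∀ A : Set (Euc n), IsCompact A → A ⊆ Ω → hNormOn σ Ω A u ≠ ⊤

def supNorm (Ω : Set (Euc n)) (u : Euc n → ℝ) : ℝ≥0∞ :=
  ⨆ x : Ω, ENNReal.ofReal |u ↑x|

def supNormW (τ : ℝ) (u : Euc n → ℝ) : ℝ≥0∞ :=
  ⨆ x : Euc n, ENNReal.ofReal (|u x| / (1 + ‖x‖ ^ τ))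

def IsLevyMeasure (K : Measure (Euc n)) : Prop :=
  K {0} = 0 ∧ (∫⁻ y, ENNReal.ofReal (min 1 (‖y‖ ^ 2)) ∂K) ≠ ⊤ ∧
    Measure.map (fun y => -y) K = K

def UnifElliptic (s lam Lam : ℝ) (K : Measure (Euc n)) : Prop :=
  (∀ r : ℝ, 0 < r →
    ENNReal.ofReal (r ^ (2 * s)) * K (ball 0 (2 * r) \ ball 0 r) ≤ ENNReal.ofReal Lam) ∧
  (∀ r : ℝ, 0 < r → ∀ e : Euc n, ‖e‖ = 1 →
    ENNReal.ofReal lam ≤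
      ENNReal.ofReal (r ^ (2 * s - 2)) * ∫⁻ y in ball 0 r, ENNReal.ofReal (⟪e, y⟫ ^ 2) ∂K)

def Lop (K : Euc n → Measure (Euc n)) (u : Euc n → ℝ) (x : Euc n) : ℝ :=
  (1 / 2) * ∫ y, (2 * u x - u (x + y) - u (x - y)) ∂(K x)

def LopTI (K : Measure (Euc n)) (u : Euc n → ℝ) (x : Euc n) : ℝ :=
  (1 / 2) * ∫ y, (2 * u x - u (x + y) - u (x - y)) ∂K

def SolvesPtwise (K : Euc n → Measure (Euc n)) (u f : Euc n → ℝ) (Ω : Set (Euc n)) : Prop :=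
  ∀ x ∈ Ω, Integrable (fun y => 2 * u x - u (x + y) - u (x - y)) (K x) ∧ Lop K u x = f x

def tvDiff (μ ν : Measure (Euc n)) (A : Set (Euc n)) : ℝ≥0∞ :=
  (μ.restrict A - ν.restrict A) Set.univ + (ν.restrict A - μ.restrict A) Set.univ

def kernelHolder (s θ : ℝ) (K : Measure (Euc n)) : ℝ≥0∞ :=
  ⨆ (ρ : ℝ) (_ : 0 < ρ) (x : Euc n) (x' : Euc n)
      (_ : x ∈ ball 0 (ρ / 2)) (_ : x' ∈ ball 0 (ρ / 2)) (_ : x ≠ x'),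
    ENNReal.ofReal (ρ ^ (2 * s + θ) / ‖x - x'‖ ^ θ) *
      tvDiff (Measure.map (fun y => x - y) K) (Measure.map (fun y => x' - y) K)
        (ball 0 (2 * ρ) \ ball 0 ρ)

def KantCond (s γ : ℝ) (μ ν : Measure (Euc n)) (c : ℝ) : Prop :=
  ∀ ρ : ℝ, 0 < ρ → ∀ φ : Euc n → ℝ, ContDiff ℝ (hDeg γ) φ →
    hSemi γ Set.univ φ ≤ 1 → φ 0 = 0 →
    |(∫ y in ball 0 (2 * ρ) \ ball 0 ρ, φ y ∂μ) -
        ∫ y in ball 0 (2 * ρ) \ ball 0 ρ, φ y ∂ν| ≤ c * ρ ^ (γ - 2 * s)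


def MeasKernel (K : Euc n → Measure (Euc n)) : Prop :=
  ∀ B : Set (Euc n), MeasurableSet B → Measurable fun x => K x B

/-- Symmetry of a divergence-form kernel: `∫_A K(x,B) dx = ∫_B K(x,A) dx`
for all disjoint Borel sets. -/
def DivSymmetric (K : Euc n → Measure (Euc n)) : Prop :=
  ∀ A B : Set (Euc n), MeasurableSet A → MeasurableSet B → Disjoint A B →
    ∫⁻ x in A, K x B = ∫⁻ x in B, K x A

/-- Uniform ellipticity of a divergence-form kernel. -/
def DivElliptic (s lam Lam : ℝ) (K : Euc n → Measure (Euc n)) : Prop :=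
  (∀ x : Euc n, ∀ r : ℝ, 0 < r →
    ENNReal.ofReal (r ^ (2 * s)) * K x (ball x (2 * r) \ ball x r) ≤ ENNReal.ofReal Lam) ∧
  (∀ x : Euc n, ∀ r : ℝ, 0 < r → ∀ e : Euc n, ‖e‖ = 1 →
    ENNReal.ofReal lam ≤
      ENNReal.ofReal (r ^ (2 * s - 2)) *
        ∫⁻ z in ball x r, ENNReal.ofReal (⟪e, x - z⟫ ^ 2) ∂(K x))

/-- Weak solution of the divergence-form equation `L(u,x) = f` in `Ω`. -/
def WeakSol (K : Euc n → Measure (Euc n)) (u f : Euc n → ℝ) (Ω : Set (Euc n)) : Prop :=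
  (∫⁻ x in Ω, ∫⁻ z, ENNReal.ofReal ((u x - u z) ^ 2) ∂(K x)) ≠ ⊤ ∧
  (∫⁻ x in Ωᶜ, ∫⁻ z in Ω, ENNReal.ofReal ((u x - u z) ^ 2) ∂(K x)) ≠ ⊤ ∧
  ∀ η : Euc n → ℝ, ContDiff ℝ (⊤ : ℕ∞) η → HasCompactSupport η → tsupport η ⊆ Ω →
    (1 / 2) * (∫ x, ∫ z, (u x - u z) * (η x - η z) ∂(K x)) = ∫ x, f x * η x

/-- `C^α` regularity in the `x`-variable of a divergence-form kernel (total variation). -/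
def XReg (s α M : ℝ) (K : Euc n → Measure (Euc n)) : Prop :=
  ∀ x h : Euc n, ∀ ρ : ℝ, 0 < ρ →
    tvDiff (Measure.map (fun z => z - h) (K (x + h))) (K x) (ball x (2 * ρ) \ ball x ρ) ≤
      ENNReal.ofReal (M * ‖h‖ ^ α * ρ ^ (-(2 * s)))

/-- Quantitative almost-evenness of a divergence-form kernel. -/
def AlmostEven (s α M : ℝ) (K : Euc n → Measure (Euc n)) : Prop :=
  ∀ x : Euc n, ∀ ρ : ℝ, 0 < ρ →
    tvDiff (Measure.map (fun z => z - x) (K x)) (Measure.map (fun z => x - z) (K x))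
        (ball 0 (2 * ρ) \ ball 0 ρ) ≤
      ENNReal.ofReal (M * ρ ^ (α - 2 * s))

/-- `C^θ` regularity in the `z`-variable of a divergence-form kernel (total variation). -/
def ZReg (s θ M : ℝ) (K : Euc n → Measure (Euc n)) : Prop :=
  ∀ x : Euc n, ∀ ρ : ℝ, 0 < ρ → ∀ h : Euc n, ‖h‖ < ρ / 2 →
    tvDiff (Measure.map (fun z => z - h) (K x)) (K x) (ball x (2 * ρ) \ ball x ρ) ≤
      ENNReal.ofReal (M * ‖h‖ ^ θ * ρ ^ (-(2 * s) - θ))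

def gradSup (u : Euc n → ℝ) : ℝ≥0∞ :=
  ⨆ x : Euc n, ENNReal.ofReal ‖fderiv ℝ u x‖

def gradSupOn (Ω : Set (Euc n)) (u : Euc n → ℝ) : ℝ≥0∞ :=
  ⨆ x : Ω, ENNReal.ofReal ‖fderiv ℝ u (x : Euc n)‖

def c1Norm (Ω : Set (Euc n)) (u : Euc n → ℝ) : ℝ≥0∞ :=
  supNorm Ω u + gradSupOn Ω u

/-! ### Total variation -/

lemma measure_le_sub_add {α : Type*} [MeasurableSpace α] (μ ν : Measure α) [IsFiniteMeasure μ]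
    [IsFiniteMeasure ν] : μ ≤ (μ - ν) + ν := by
  obtain ⟨s, hs⟩ := exists_isHahnDecomposition μ ν
  have hm := hs.measurableSet
  calc μ = μ.restrict s + μ.restrict sᶜ := (Measure.restrict_add_restrict_compl hm).symm
    _ ≤ ((μ - ν) + ν).restrict s + ((μ - ν) + ν).restrict sᶜ := add_le_add ?_ ?_
    _ = (μ - ν) + ν := Measure.restrict_add_restrict_compl hm
  · refine hs.le_on.trans ?_
    rw [Measure.restrict_add]
    exact Measure.le_add_left le_rfl
  · rw [Measure.restrict_add, Measure.restrict_sub_eq_restrict_sub_restrict hm.compl,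
      Measure.sub_add_cancel_of_le hs.ge_on_compl]

lemma lintegral_le_add_sub {α : Type*} [MeasurableSpace α] (μ ν : Measure α) [IsFiniteMeasure μ]
    [IsFiniteMeasure ν] (g : α → ℝ≥0∞) {G : ℝ≥0∞} (hG : ∀ x, g x ≤ G) :
    ∫⁻ x, g x ∂μ ≤ ∫⁻ x, g x ∂ν + G * (μ - ν) univ := by
  calc ∫⁻ x, g x ∂μ ≤ ∫⁻ x, g x ∂((μ - ν) + ν) :=
        lintegral_mono' (measure_le_sub_add μ ν) le_rfl
    _ = ∫⁻ x, g x ∂(μ - ν) + ∫⁻ x, g x ∂ν := lintegral_add_measure _ _ _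
    _ ≤ G * (μ - ν) univ + ∫⁻ x, g x ∂ν := by
        gcongr
        exact (lintegral_mono hG).trans (by simp)
    _ = _ := add_comm _ _

lemma integral_nonneg_sub_le {α : Type*} [MeasurableSpace α] (μ ν : Measure α) [IsFiniteMeasure μ]
    [IsFiniteMeasure ν] {g : α → ℝ} (hg : Measurable g) {G : ℝ} (hg0 : ∀ x, 0 ≤ g x)
    (hG : ∀ x, g x ≤ G) :
    ∫ x, g x ∂μ - ∫ x, g x ∂ν ≤ G * ((μ - ν) univ).toReal := by
  rcases isEmpty_or_nonempty α with h | ⟨⟨x₀⟩⟩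
  · simp [Measure.eq_zero_of_isEmpty]
  have hG0 : 0 ≤ G := (hg0 x₀).trans (hG x₀)
  have hfin : (μ - ν) univ ≠ ⊤ :=
    ne_top_of_le_ne_top (measure_ne_top μ univ) (Measure.sub_le (μ := μ) (ν := ν) univ)
  have key := lintegral_le_add_sub μ ν (fun x => ENNReal.ofReal (g x))
    (G := ENNReal.ofReal G) (fun x => ENNReal.ofReal_le_ofReal (hG x))
  have hint : ∀ ξ : Measure α, IsFiniteMeasure ξ → Integrable g ξ := fun ξ _ =>
    Integrable.of_bound hg.aestronglyMeasurable G
      (Filter.Eventually.of_forall fun x => by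
        rw [Real.norm_eq_abs, abs_of_nonneg (hg0 x)]; exact hG x)
  rw [← ofReal_integral_eq_lintegral_ofReal (hint μ inferInstance)
      (Filter.Eventually.of_forall hg0),
    ← ofReal_integral_eq_lintegral_ofReal (hint ν inferInstance)
      (Filter.Eventually.of_forall hg0), ← ENNReal.ofReal_toReal hfin,
    ← ENNReal.ofReal_mul hG0, ← ENNReal.ofReal_add (integral_nonneg hg0) (by positivity),
    ENNReal.ofReal_le_ofReal_iff
      (add_nonneg (integral_nonneg hg0) (by positivity))] at key
  linarith

lemma abs_integral_sub_le {α : Type*} [MeasurableSpace α] (μ ν : Measure α) [IsFiniteMeasure μ]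
    [IsFiniteMeasure ν] {g : α → ℝ} (hg : Measurable g) {G : ℝ} (hG : ∀ x, |g x| ≤ G) :
    |∫ x, g x ∂μ - ∫ x, g x ∂ν| ≤ G * (((μ - ν) univ).toReal + ((ν - μ) univ).toReal) := by
  have hint : ∀ ξ : Measure α, IsFiniteMeasure ξ →
      ∫ x, g x ∂ξ = ∫ x, max (g x) 0 ∂ξ - ∫ x, max (-g x) 0 ∂ξ := fun ξ _ => by
    have h1 : Integrable g ξ := Integrable.of_bound hg.aestronglyMeasurable G
      (Filter.Eventually.of_forall fun x => hG x)
    rw [← integral_sub h1.pos_part h1.neg_part]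
    exact integral_congr_ae (Filter.Eventually.of_forall fun x => by
      simp only []
      rcases le_total (g x) 0 with h | h
      · rw [max_eq_right h, max_eq_left (by linarith)]; ring
      · rw [max_eq_left h, max_eq_right (by linarith)]; ring)
  have hp0 : ∀ x, 0 ≤ max (g x) 0 := fun x => le_max_right _ _
  have hn0 : ∀ x, 0 ≤ max (-g x) 0 := fun x => le_max_right _ _
  have hp : ∀ x, max (g x) 0 ≤ G := fun x =>
    max_le ((le_abs_self _).trans (hG x)) ((abs_nonneg _).trans (hG x))
  have hn : ∀ x, max (-g x) 0 ≤ G := fun x =>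
    max_le ((neg_le_abs _).trans (hG x)) ((abs_nonneg _).trans (hG x))
  have mp : Measurable fun x => max (g x) 0 := hg.max measurable_const
  have mn : Measurable fun x => max (-g x) 0 := hg.neg.max measurable_const
  rw [hint μ inferInstance, hint ν inferInstance, abs_le]
  have a1 := integral_nonneg_sub_le μ ν mp hp0 hp
  have a2 := integral_nonneg_sub_le ν μ mp hp0 hp
  have a3 := integral_nonneg_sub_le μ ν mn hn0 hn
  have a4 := integral_nonneg_sub_le ν μ mn hn0 hn
  constructor <;> nlinarith

lemma abs_setIntegral_sub_le_tvDiff (μ ν : Measure (Euc n)) {A : Set (Euc n)}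
    (hμ : μ A ≠ ⊤) (hν : ν A ≠ ⊤) {g : Euc n → ℝ} (hg : Measurable g) {G t : ℝ}
    (hG : ∀ x, |g x| ≤ G) (ht0 : 0 ≤ t) (ht : tvDiff μ ν A ≤ ENNReal.ofReal t) :
    |∫ x in A, g x ∂μ - ∫ x in A, g x ∂ν| ≤ G * t := by
  have : IsFiniteMeasure (μ.restrict A) := ⟨by simpa using hμ.lt_top⟩
  have : IsFiniteMeasure (ν.restrict A) := ⟨by simpa using hν.lt_top⟩
  refine (abs_integral_sub_le _ _ hg hG).trans ?_
  refine mul_le_mul_of_nonneg_left ?_ ((abs_nonneg _).trans (hG 0))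
  have h : tvDiff μ ν A ≠ ⊤ := ne_top_of_le_ne_top ENNReal.ofReal_ne_top ht
  unfold tvDiff at h ht
  rw [← ENNReal.toReal_add (ENNReal.add_ne_top.1 h).1 (ENNReal.add_ne_top.1 h).2]
  exact ENNReal.toReal_le_of_le_ofReal ht0 ht

/-! ### Moments of measures with bounded annular mass -/

/-- Upper bound of order `2s` for the mass of dyadic annuli. -/
def AnnulusBound (s Lam : ℝ) (ν : Measure (Euc n)) : Prop :=
  ∀ r : ℝ, 0 < r → ν (ball 0 (2 * r) \ ball 0 r) ≤ ENNReal.ofReal (Lam * r ^ (-(2 * s)))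

lemma AnnulusBound.lintegral_le {s Lam p : ℝ} {ν : Measure (Euc n)} (h : AnnulusBound s Lam ν)
    (hp : 0 ≤ p) (hLam : 0 ≤ Lam) {r₀ a : ℝ} (hr₀ : 0 < r₀) (ha : 0 < a)
    (hlt : a ^ (p - 2 * s) < 1)
    {S : Set (Euc n)} (hS : S ⊆ ⋃ k : ℕ, ball 0 (2 * (r₀ * a ^ k)) \ ball 0 (r₀ * a ^ k)) :
    ∫⁻ y in S, ENNReal.ofReal (‖y‖ ^ p) ∂ν ≤
      ENNReal.ofReal (2 ^ p * Lam * (1 - a ^ (p - 2 * s))⁻¹ * r₀ ^ (p - 2 * s)) := by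
  have hr : ∀ k : ℕ, 0 < r₀ * a ^ k := fun k => by positivity
  have hq0 : 0 ≤ a ^ (p - 2 * s) := by positivity
  have hterm : ∀ k : ℕ, ∫⁻ y in ball 0 (2 * (r₀ * a ^ k)) \ ball 0 (r₀ * a ^ k),
      ENNReal.ofReal (‖y‖ ^ p) ∂ν ≤
        ENNReal.ofReal (2 ^ p * Lam * r₀ ^ (p - 2 * s) * (a ^ (p - 2 * s)) ^ k) := by
    intro k
    have hb : ∫⁻ y in ball 0 (2 * (r₀ * a ^ k)) \ ball 0 (r₀ * a ^ k),
        ENNReal.ofReal (‖y‖ ^ p) ∂ν ≤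
        ∫⁻ y in ball 0 (2 * (r₀ * a ^ k)) \ ball 0 (r₀ * a ^ k),
          ENNReal.ofReal ((2 * (r₀ * a ^ k)) ^ p) ∂ν := by
      refine setLIntegral_mono' (measurableSet_ball.diff measurableSet_ball) fun y hy => ?_
      refine ENNReal.ofReal_le_ofReal (Real.rpow_le_rpow (norm_nonneg _) ?_ hp)
      exact (mem_ball_zero_iff.1 hy.1).le
    refine hb.trans ?_
    rw [setLIntegral_const]
    refine (mul_le_mul_right (h _ (hr k)) _).trans ?_
    rw [← ENNReal.ofReal_mul (by positivity)]
    refine ENNReal.ofReal_le_ofReal (le_of_eq ?_)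
    rw [Real.mul_rpow (by norm_num) (hr k).le, sub_eq_add_neg, Real.rpow_add hr₀,
      Real.mul_rpow hr₀.le (by positivity), Real.mul_rpow hr₀.le (by positivity),
      ← Real.rpow_natCast (a ^ _), ← Real.rpow_mul ha.le, add_mul, Real.rpow_add ha,
      ← Real.rpow_natCast a, ← Real.rpow_mul ha.le, ← Real.rpow_mul ha.le,
      mul_comm (k : ℝ) p, mul_comm (k : ℝ)]
    ring
  calc ∫⁻ y in S, ENNReal.ofReal (‖y‖ ^ p) ∂ν
      ≤ ∫⁻ y in ⋃ k : ℕ, ball 0 (2 * (r₀ * a ^ k)) \ ball 0 (r₀ * a ^ k),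
          ENNReal.ofReal (‖y‖ ^ p) ∂ν := lintegral_mono_set hS
    _ ≤ ∑' k : ℕ, ∫⁻ y in ball 0 (2 * (r₀ * a ^ k)) \ ball 0 (r₀ * a ^ k),
          ENNReal.ofReal (‖y‖ ^ p) ∂ν := lintegral_iUnion_le _ _
    _ ≤ ∑' k : ℕ, ENNReal.ofReal (2 ^ p * Lam * r₀ ^ (p - 2 * s) * (a ^ (p - 2 * s)) ^ k) :=
        ENNReal.tsum_le_tsum hterm
    _ = ENNReal.ofReal (∑' k : ℕ, 2 ^ p * Lam * r₀ ^ (p - 2 * s) * (a ^ (p - 2 * s)) ^ k) :=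
        (ENNReal.ofReal_tsum_of_nonneg (fun k => by positivity)
          ((summable_geometric_of_lt_one hq0 hlt).mul_left _)).symm
    _ = _ := by
        rw [tsum_mul_left, tsum_geometric_of_lt_one hq0 hlt]
        congr 1; ring

lemma exists_near_moment (s Lam p : ℝ) (hs : 0 < s) (hLam : 0 ≤ Lam) (hp : 2 * s < p) :
    ∃ C : ℝ, 0 ≤ C ∧ ∀ ν : Measure (Euc n), AnnulusBound s Lam ν → ∀ τ : ℝ, 0 < τ →
      ∫⁻ y in ball 0 τ, ENNReal.ofReal (‖y‖ ^ p) ∂ν ≤ ENNReal.ofReal (C * τ ^ (p - 2 * s)) := by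
  have hlt : (1 / 2 : ℝ) ^ (p - 2 * s) < 1 :=
    Real.rpow_lt_one (by norm_num) (by norm_num) (by linarith)
  refine ⟨2 ^ p * Lam * (1 - (1 / 2) ^ (p - 2 * s))⁻¹ * (1 / 2) ^ (p - 2 * s), ?_, ?_⟩
  · have : 0 < 1 - (1 / 2 : ℝ) ^ (p - 2 * s) := by linarith
    positivity
  intro ν hν τ hτ
  have hsub : ball (0 : Euc n) τ ⊆ {0} ∪ (ball 0 τ \ {0}) := fun y hy => by
    by_cases h : y = 0
    · exact Or.inl h
    · exact Or.inr ⟨hy, h⟩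
  have hcov : ball (0 : Euc n) τ \ {0} ⊆
      ⋃ k : ℕ, ball 0 (2 * (τ / 2 * (1 / 2) ^ k)) \ ball 0 (τ / 2 * (1 / 2) ^ k) := by
    intro y hy
    have hy0 : 0 < ‖y‖ := norm_pos_iff.2 hy.2
    have hy1 : ‖y‖ < τ := mem_ball_zero_iff.1 hy.1
    have hex : ∃ k : ℕ, τ / 2 * (1 / 2) ^ k ≤ ‖y‖ := by
      obtain ⟨k, hk⟩ := exists_pow_lt_of_lt_one (show 0 < ‖y‖ / (τ / 2) by positivity)
        (show (1 / 2 : ℝ) < 1 by norm_num)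
      refine ⟨k, ?_⟩
      rw [lt_div_iff₀ (by positivity)] at hk
      linarith
    classical
    refine mem_iUnion.2 ⟨Nat.find hex, ?_, ?_⟩
    · rw [mem_ball_zero_iff]
      rcases hk : Nat.find hex with _ | k
      · simp; linarith
      · have := Nat.find_min hex (m := k) (by omega)
        rw [pow_succ]
        push Not at this
        linarith
    · rw [mem_ball_zero_iff, not_lt]
      exact Nat.find_spec hex
  calc ∫⁻ y in ball 0 τ, ENNReal.ofReal (‖y‖ ^ p) ∂ν
      ≤ ∫⁻ y in {0} ∪ (ball 0 τ \ {0}), ENNReal.ofReal (‖y‖ ^ p) ∂ν := lintegral_mono_set hsub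
    _ ≤ ∫⁻ y in {0}, ENNReal.ofReal (‖y‖ ^ p) ∂ν +
        ∫⁻ y in ball 0 τ \ {0}, ENNReal.ofReal (‖y‖ ^ p) ∂ν := lintegral_union_le _ _ _
    _ = ∫⁻ y in ball 0 τ \ {0}, ENNReal.ofReal (‖y‖ ^ p) ∂ν := by
        rw [lintegral_singleton, norm_zero, Real.zero_rpow (by linarith)]
        simp
    _ ≤ _ := hν.lintegral_le (by linarith) hLam (by positivity) (by norm_num) hlt hcov
    _ = _ := by
        rw [div_eq_mul_one_div τ 2, Real.mul_rpow hτ.le (by norm_num)]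
        congr 1; ring

lemma exists_far_moment (s Lam p : ℝ) (hLam : 0 ≤ Lam) (hp0 : 0 ≤ p) (hp : p < 2 * s) :
    ∃ C : ℝ, 0 ≤ C ∧ ∀ ν : Measure (Euc n), AnnulusBound s Lam ν → ∀ τ : ℝ, 0 < τ →
      ∫⁻ y in (ball 0 τ)ᶜ, ENNReal.ofReal (‖y‖ ^ p) ∂ν ≤
        ENNReal.ofReal (C * τ ^ (p - 2 * s)) := by
  have hlt : (2 : ℝ) ^ (p - 2 * s) < 1 :=
    Real.rpow_lt_one_of_one_lt_of_neg (by norm_num) (by linarith)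
  refine ⟨2 ^ p * Lam * (1 - 2 ^ (p - 2 * s))⁻¹, ?_, ?_⟩
  · have : 0 < 1 - (2 : ℝ) ^ (p - 2 * s) := by linarith
    positivity
  intro ν hν τ hτ
  refine hν.lintegral_le hp0 hLam hτ (by norm_num) hlt ?_
  intro y hy
  have hy1 : τ ≤ ‖y‖ := by simpa using hy
  have hex : ∃ k : ℕ, ‖y‖ < 2 * (τ * 2 ^ k) := by
    obtain ⟨k, hk⟩ := pow_unbounded_of_one_lt (‖y‖ / (2 * τ)) (show (1 : ℝ) < 2 by norm_num)
    refine ⟨k, ?_⟩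
    rw [div_lt_iff₀ (by positivity)] at hk
    linarith
  classical
  refine mem_iUnion.2 ⟨Nat.find hex, ?_, ?_⟩
  · rw [mem_ball_zero_iff]
    exact Nat.find_spec hex
  · rw [mem_ball_zero_iff, not_lt]
    rcases hk : Nat.find hex with _ | k
    · simpa using hy1
    · have := Nat.find_min hex (m := k) (by omega)
      rw [pow_succ]
      push Not at this
      linarith

open ProbabilityTheory

/-! ### The jump measure away from the diagonal -/

lemma exists_truncated_kernel {K : Euc n → Measure (Euc n)} (hK : MeasKernel K)
    (hfar : ∀ τ : ℝ, 0 < τ → ∃ C : ℝ≥0∞, C < ⊤ ∧ ∀ x, K x {z | τ ≤ ‖z - x‖} ≤ C)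
    {σ : ℝ} (hσ : 0 < σ) :
    ∃ κ : Kernel (Euc n) (Euc n), IsFiniteKernel κ ∧
      ∀ x, (κ x).restrict {z | σ ≤ ‖z - x‖} = (K x).restrict {z | σ ≤ ‖z - x‖} := by
  classical
  let d := TopologicalSpace.denseSeq (Euc n)
  have hex : ∀ x : Euc n, ∃ i, ‖x - d i‖ < σ / 4 := fun x => by
    obtain ⟨i, hi⟩ := (TopologicalSpace.denseRange_denseSeq (Euc n)).exists_dist_lt x
      (show 0 < σ / 4 by positivity)
    exact ⟨i, by rwa [← dist_eq_norm]⟩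
  let G : ℕ → Set (Euc n) := fun i => {z | 3 * σ / 4 ≤ ‖z - d i‖}
  have hG : ∀ i, MeasurableSet (G i) := fun i =>
    measurableSet_le measurable_const (by fun_prop)
  have hmeas : Measurable fun x => (K x).restrict (G (Nat.find (hex x))) := by
    refine Measurable.find (f := fun i x => (K x).restrict (G i)) (fun i => ?_) (fun i => ?_) hex
    · refine Measure.measurable_of_measurable_coe _ fun B hB => ?_
      simp_rw [Measure.restrict_apply hB]
      exact hK _ (hB.inter (hG i))
    · exact measurableSet_lt (by fun_prop) measurable_const
  obtain ⟨C, hC, hKC⟩ := hfar (σ / 2) (by positivity)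
  refine ⟨⟨_, hmeas⟩, ⟨C, hC, fun x => ?_⟩, fun x => ?_⟩
  · refine (le_of_eq ?_).trans
      ((measure_mono (s := G (Nat.find (hex x))) ?_).trans (hKC x))
    · exact Measure.restrict_apply_univ _
    · intro z hz
      have h1 := Nat.find_spec (hex x)
      have h2 : 3 * σ / 4 ≤ ‖z - d (Nat.find (hex x))‖ := hz
      have h3 := norm_sub_le_norm_sub_add_norm_sub z x (d (Nat.find (hex x)))
      simp only [mem_ofPred_eq]
      linarith
  · change ((K x).restrict (G (Nat.find (hex x)))).restrict _ = _
    rw [Measure.restrict_restrict (measurableSet_le measurable_const (by fun_prop))]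
    congr 1
    refine inter_eq_left.2 fun z hz => ?_
    have h1 := Nat.find_spec (hex x)
    have h2 : σ ≤ ‖z - x‖ := hz
    have h3 := norm_sub_le_norm_sub_add_norm_sub z (d (Nat.find (hex x))) x
    rw [norm_sub_rev (d _) x] at h3
    change 3 * σ / 4 ≤ _
    linarith

lemma measurableSet_far (τ : ℝ) (x : Euc n) : MeasurableSet {z | τ ≤ ‖z - x‖} :=
  measurableSet_le measurable_const (by fun_prop)

lemma restrict_compProd_swap {K : Euc n → Measure (Euc n)} (hsym : DivSymmetric K)
    {σ : ℝ} (hσ : 0 < σ) (κ : Kernel (Euc n) (Euc n)) [IsFiniteKernel κ]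
    (hκ : ∀ x, (κ x).restrict {z | σ ≤ ‖z - x‖} = (K x).restrict {z | σ ≤ ‖z - x‖})
    {A B : Set (Euc n)} (hA : MeasurableSet A) (hB : MeasurableSet B) (hfA : volume A ≠ ⊤)
    (hAB : ∀ x ∈ A, ∀ z ∈ B, σ ≤ ‖z - x‖) :
    (volume ⊗ₘ κ).restrict (A ×ˢ B) =
      ((volume ⊗ₘ κ).map Prod.swap).restrict (A ×ˢ B) := by
  have hκK : ∀ x, ∀ S : Set (Euc n), (∀ z ∈ S, σ ≤ ‖z - x‖) → κ x S = K x S := fun x S hS => by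
    rw [← Measure.restrict_eq_self (κ x) (show S ⊆ {z | σ ≤ ‖z - x‖} from hS), hκ,
      Measure.restrict_eq_self (K x) (show S ⊆ {z | σ ≤ ‖z - x‖} from hS)]
  have : IsFiniteMeasure ((volume ⊗ₘ κ).restrict (A ×ˢ B)) := by
    refine ⟨?_⟩
    rw [Measure.restrict_apply_univ, Measure.compProd_apply_prod hA hB]
    refine (lintegral_mono fun x => Kernel.measure_le_bound κ x B).trans_lt ?_
    simp only [lintegral_const, Measure.restrict_apply_univ]
    exact ENNReal.mul_lt_top (Kernel.bound_lt_top κ) hfA.lt_top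
  refine Measure.ext_prod fun {S T} hS hT => ?_
  rw [Measure.restrict_apply (hS.prod hT), Measure.restrict_apply (hS.prod hT), prod_inter_prod,
    Measure.map_apply measurable_swap ((hS.inter hA).prod (hT.inter hB)), preimage_swap_prod,
    Measure.compProd_apply_prod (hS.inter hA) (hT.inter hB),
    Measure.compProd_apply_prod (hT.inter hB) (hS.inter hA)]
  rw [setLIntegral_congr_fun (hS.inter hA) (g := fun x => K x (T ∩ B))
      (fun x hx => hκK x _ fun z hz => hAB x hx.2 z hz.2),
    setLIntegral_congr_fun (hT.inter hB) (g := fun x => K x (S ∩ A))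
      (fun x hx => hκK x _ fun z hz => by rw [norm_sub_rev]; exact hAB z hz.2 x hx.2)]
  refine hsym _ _ (hS.inter hA) (hT.inter hB) (disjoint_left.2 fun x hx hx' => ?_)
  have := hAB x hx.2 x hx'.2
  simp at this
  linarith

lemma exists_symmetric_measure {K : Euc n → Measure (Euc n)} (hK : MeasKernel K)
    (hsym : DivSymmetric K)
    (hfar : ∀ τ : ℝ, 0 < τ → ∃ C : ℝ≥0∞, C < ⊤ ∧ ∀ x, K x {z | τ ≤ ‖z - x‖} ≤ C)
    {τ : ℝ} (hτ : 0 < τ) :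
    ∃ m : Measure (Euc n × Euc n), m.map Prod.swap = m ∧
      (∀ F : Euc n × Euc n → ℝ≥0∞, Measurable F →
        ∫⁻ p, F p ∂m = ∫⁻ x, ∫⁻ z in {z | τ ≤ ‖z - x‖}, F (x, z) ∂(K x)) ∧
      (∀ F : Euc n × Euc n → ℝ, Integrable F m →
        Integrable (fun x => ∫ z in {z | τ ≤ ‖z - x‖}, F (x, z) ∂(K x)) ∧
        ∫ p, F p ∂m = ∫ x, ∫ z in {z | τ ≤ ‖z - x‖}, F (x, z) ∂(K x)) := by
  obtain ⟨κ, hκf, hκ⟩ := exists_truncated_kernel hK hfar (show 0 < τ / 2 by positivity)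
  have hκτ : ∀ x, (κ x).restrict {z | τ ≤ ‖z - x‖} = (K x).restrict {z | τ ≤ ‖z - x‖} := by
    intro x
    have hsub : {z : Euc n | τ ≤ ‖z - x‖} ⊆ {z | τ / 2 ≤ ‖z - x‖} := fun z hz => by
      simp only [mem_ofPred_eq] at hz ⊢; linarith
    rw [← Measure.restrict_restrict_of_subset hsub, hκ, Measure.restrict_restrict_of_subset hsub]
  let D : Set (Euc n × Euc n) := {p | τ ≤ ‖p.2 - p.1‖}
  have hD : MeasurableSet D := measurableSet_le measurable_const (by fun_prop)
  have hswapD : Prod.swap ⁻¹' D = D := by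
    ext p; simp [D, norm_sub_rev]
  let d := TopologicalSpace.denseSeq (Euc n)
  let I := {i : ℕ × ℕ // ∀ x ∈ ball (d i.1) (τ / 8), ∀ z ∈ ball (d i.2) (τ / 8), τ / 2 ≤ ‖z - x‖}
  let U : Set (Euc n × Euc n) := ⋃ i : I, ball (d i.1.1) (τ / 8) ×ˢ ball (d i.1.2) (τ / 8)
  have hDU : D ⊆ U := by
    intro p hp
    have hp' : τ ≤ ‖p.2 - p.1‖ := hp
    obtain ⟨i, hi⟩ := (TopologicalSpace.denseRange_denseSeq (Euc n)).exists_dist_lt p.1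
      (show 0 < τ / 16 by positivity)
    obtain ⟨j, hj⟩ := (TopologicalSpace.denseRange_denseSeq (Euc n)).exists_dist_lt p.2
      (show 0 < τ / 16 by positivity)
    rw [dist_eq_norm] at hi hj
    have hball : ∀ a b : Euc n, ‖a - b‖ < τ / 16 → a ∈ ball b (τ / 8) := fun a b h => by
      rw [mem_ball, dist_eq_norm]; linarith
    refine mem_iUnion.2 ⟨⟨(i, j), fun x hx z hz => ?_⟩, hball _ _ hi, hball _ _ hj⟩
    rw [mem_ball, dist_eq_norm] at hx hz
    have h1 := norm_sub_le_norm_sub_add_norm_sub p.2 (d j) p.1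
    have h2 := norm_sub_le_norm_sub_add_norm_sub (d j) z p.1
    have h3 := norm_sub_le_norm_sub_add_norm_sub z x p.1
    have h4 := norm_sub_le_norm_sub_add_norm_sub x (d i) p.1
    rw [norm_sub_rev (d j) z] at h2
    rw [norm_sub_rev (d i) p.1] at h4
    dsimp only at hx hz
    linarith
  have hU : (volume ⊗ₘ κ).restrict U = ((volume ⊗ₘ κ).map Prod.swap).restrict U :=
    Measure.restrict_iUnion_congr.2 fun i =>
      restrict_compProd_swap hsym (show 0 < τ / 2 by positivity) κ hκ measurableSet_ball
        measurableSet_ball measure_ball_lt_top.ne i.2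
  have hDD : (volume ⊗ₘ κ).restrict D = ((volume ⊗ₘ κ).map Prod.swap).restrict D := by
    rw [← Measure.restrict_restrict_of_subset hDU, hU, Measure.restrict_restrict_of_subset hDU]
  refine ⟨(volume ⊗ₘ κ).restrict D, ?_, fun F hF => ?_, fun F hF => ?_⟩
  · calc ((volume ⊗ₘ κ).restrict D).map Prod.swap
        = ((volume ⊗ₘ κ).restrict (Prod.swap ⁻¹' D)).map Prod.swap := by rw [hswapD]
      _ = ((volume ⊗ₘ κ).map Prod.swap).restrict D :=
          (Measure.restrict_map measurable_swap hD).symm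
      _ = (volume ⊗ₘ κ).restrict D := hDD.symm
  · rw [← lintegral_indicator hD, Measure.lintegral_compProd (hF.indicator hD)]
    refine lintegral_congr fun x => ?_
    rw [← hκτ, ← lintegral_indicator (measurableSet_far τ x)]
    rfl
  · replace hF := (integrable_indicator_iff hD).2 hF
    have h : ∀ x, ∫ z in {z | τ ≤ ‖z - x‖}, F (x, z) ∂(K x) =
        ∫ z, D.indicator F (x, z) ∂(κ x) := fun x => by
      rw [← hκτ, ← integral_indicator (measurableSet_far τ x)]
      rfl
    simp_rw [h]
    refine ⟨MeasureTheory.Integrable.integral_compProd hF, ?_⟩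
    rw [← integral_indicator hD, Measure.integral_compProd hF]

/-! ### Testing the weak formulation with a fixed cut-off of small jumps -/

lemma setLIntegral_translate (μ : Measure (Euc n)) (x : Euc n) {S : Set (Euc n)}
    (hS : MeasurableSet S) {g : Euc n → ℝ≥0∞} (hg : Measurable g) :
    ∫⁻ y in S, g y ∂(μ.map fun z => z - x) = ∫⁻ z in {z | z - x ∈ S}, g (z - x) ∂μ :=
  setLIntegral_map hS hg (by fun_prop)

lemma near_moment_translate {μ : Measure (Euc n)} {x : Euc n} {τ p c : ℝ}
    (h : ∫⁻ y in ball 0 τ, ENNReal.ofReal (‖y‖ ^ p) ∂(μ.map fun z => z - x) ≤ ENNReal.ofReal c) :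
    ∫⁻ z in {z | τ ≤ ‖z - x‖}ᶜ, ENNReal.ofReal (‖z - x‖ ^ p) ∂μ ≤ ENNReal.ofReal c := by
  rw [setLIntegral_translate _ _ measurableSet_ball (by fun_prop)] at h
  have : {z | τ ≤ ‖z - x‖}ᶜ = {z | z - x ∈ ball 0 τ} := by ext; simp
  rwa [this]

lemma far_moment_translate {μ : Measure (Euc n)} {x : Euc n} {τ p c : ℝ}
    (h : ∫⁻ y in (ball 0 τ)ᶜ, ENNReal.ofReal (‖y‖ ^ p) ∂(μ.map fun z => z - x) ≤
      ENNReal.ofReal c) :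
    ∫⁻ z in {z | τ ≤ ‖z - x‖}, ENNReal.ofReal (‖z - x‖ ^ p) ∂μ ≤ ENNReal.ofReal c := by
  rw [setLIntegral_translate _ _ measurableSet_ball.compl (by fun_prop)] at h
  have : {z | τ ≤ ‖z - x‖} = {z | z - x ∈ (ball 0 τ)ᶜ} := by ext; simp
  rwa [this]

lemma far_mass_bound {s Lam : ℝ} (hs : 0 < s) (hLam : 0 ≤ Lam) {K : Euc n → Measure (Euc n)}
    (hann : ∀ x, AnnulusBound s Lam ((K x).map fun z => z - x)) (τ : ℝ) (hτ : 0 < τ) :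
    ∃ C : ℝ≥0∞, C < ⊤ ∧ ∀ x, K x {z | τ ≤ ‖z - x‖} ≤ C := by
  obtain ⟨C, -, hC⟩ := exists_far_moment (n := n) s Lam 0 hLam le_rfl (by linarith)
  refine ⟨ENNReal.ofReal (C * τ ^ (0 - 2 * s)), ENNReal.ofReal_lt_top, fun x => ?_⟩
  have := far_moment_translate (hC _ (hann x) τ hτ)
  simpa using this

/-- A measurable function dominated by a function of finite upper integral is integrable, with the
corresponding bound on its integral. -/
lemma integrable_and_abs_integral_le {α : Type*} [MeasurableSpace α] {μ : Measure α} {g w : α → ℝ}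
    (hg : AEStronglyMeasurable g μ) {c a : ℝ} (ha : 0 ≤ a) (hc : 0 ≤ c)
    (hgw : ∀ᵐ x ∂μ, |g x| ≤ a * w x)
    (hw : ∫⁻ x, ENNReal.ofReal (w x) ∂μ ≤ ENNReal.ofReal c) :
    Integrable g μ ∧ |∫ x, g x ∂μ| ≤ a * c := by
  have h1 : ∫⁻ x, ‖g x‖ₑ ∂μ ≤ ENNReal.ofReal (a * c) := by
    calc ∫⁻ x, ‖g x‖ₑ ∂μ ≤ ∫⁻ x, ENNReal.ofReal a * ENNReal.ofReal (w x) ∂μ := by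
          refine lintegral_mono_ae (hgw.mono fun x hx => ?_)
          rw [← ENNReal.ofReal_mul ha, Real.enorm_eq_ofReal_abs]
          exact ENNReal.ofReal_le_ofReal hx
      _ = ENNReal.ofReal a * ∫⁻ x, ENNReal.ofReal (w x) ∂μ :=
          lintegral_const_mul' _ _ ENNReal.ofReal_ne_top
      _ ≤ ENNReal.ofReal a * ENNReal.ofReal c := by gcongr
      _ = _ := (ENNReal.ofReal_mul ha).symm
  refine ⟨⟨hg, h1.trans_lt ENNReal.ofReal_lt_top⟩, ?_⟩
  have h2 := (enorm_integral_le_lintegral_enorm g).trans h1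
  rw [Real.enorm_eq_ofReal_abs, ENNReal.ofReal_le_ofReal_iff (by positivity)] at h2
  exact h2

lemma weak_form_truncated {s Lam β C₁ C₂ : ℝ} (hs : 0 < s) (hLam : 0 ≤ Lam) (hβ : 0 < β)
    (hC₁ : 0 ≤ C₁) (hC₂ : 0 ≤ C₂)
    (hnear : ∀ ν : Measure (Euc n), AnnulusBound s Lam ν → ∀ τ : ℝ, 0 < τ →
      ∫⁻ y in ball 0 τ, ENNReal.ofReal (‖y‖ ^ (1 + β)) ∂ν ≤
        ENNReal.ofReal (C₁ * τ ^ (1 + β - 2 * s)))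
    (hfar : ∀ ν : Measure (Euc n), AnnulusBound s Lam ν → ∀ τ : ℝ, 0 < τ →
      ∫⁻ y in (ball 0 τ)ᶜ, ENNReal.ofReal (‖y‖ ^ β) ∂ν ≤ ENNReal.ofReal (C₂ * τ ^ (β - 2 * s)))
    {K : Euc n → Measure (Euc n)} (hK : MeasKernel K) (hsym : DivSymmetric K)
    (hann : ∀ x, AnnulusBound s Lam ((K x).map fun z => z - x))
    {u : Euc n → ℝ} (huc : Continuous u) (hu : ∀ x y, |u x - u y| ≤ ‖x - y‖ ^ β)
    {φ : Euc n → ℝ} (hφc : Continuous φ) {x₀ : Euc n} {r : ℝ}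
    (hφ0 : ∀ x, x ∉ ball x₀ r → φ x = 0) {Lφ Mφ : ℝ} (hLφ : 0 ≤ Lφ) (hMφ : ∀ x, |φ x| ≤ Mφ)
    (hφL : ∀ x y, |φ x - φ y| ≤ Lφ * ‖x - y‖) {τ : ℝ} (hτ : 0 < τ) :
    Integrable (fun x => φ x * ∫ z in {z | τ ≤ ‖z - x‖}, (u x - u z) ∂(K x)) ∧
    |(1 / 2) * (∫ x, ∫ z, (u x - u z) * (φ x - φ z) ∂(K x)) -
        ∫ x, φ x * ∫ z in {z | τ ≤ ‖z - x‖}, (u x - u z) ∂(K x)| ≤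
      Lφ * (C₁ * τ ^ (1 + β - 2 * s)) * (volume (ball x₀ (r + τ))).toReal := by
  have hM0 : 0 ≤ Mφ := (abs_nonneg _).trans (hMφ 0)
  have hsupp : HasCompactSupport φ := HasCompactSupport.intro (isCompact_closedBall x₀ r)
    fun x hx => hφ0 x fun h => hx (ball_subset_closedBall h)
  have hφi : Integrable φ := hφc.integrable_of_hasCompactSupport hsupp
  let g : Euc n × Euc n → ℝ := fun p => (u p.1 - u p.2) * (φ p.1 - φ p.2)
  have hgc : Continuous g := by fun_prop
  have hgx : ∀ x, Continuous fun z => g (x, z) := fun x => by fun_prop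
  have hgnear : ∀ x, ∀ t > 0, IntegrableOn (fun z => g (x, z)) {z | t ≤ ‖z - x‖}ᶜ (K x) ∧
      |∫ z in {z | t ≤ ‖z - x‖}ᶜ, g (x, z) ∂(K x)| ≤ Lφ * (C₁ * t ^ (1 + β - 2 * s)) := by
    intro x t ht
    refine integrable_and_abs_integral_le (hgx x).aestronglyMeasurable hLφ (by positivity)
      (w := fun z => ‖z - x‖ ^ (1 + β)) (Filter.Eventually.of_forall fun z => ?_)
      (near_moment_translate (hnear _ (hann x) t ht))
    have h1 := hu x z
    have h2 := hφL x z
    rw [norm_sub_rev] at h1 h2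
    have h3 : ‖z - x‖ ^ (1 + β) = ‖z - x‖ * ‖z - x‖ ^ β := by
      rw [Real.rpow_add' (norm_nonneg _) (by linarith), Real.rpow_one]
    change |(u x - u z) * (φ x - φ z)| ≤ _
    rw [abs_mul, h3]
    calc |u x - u z| * |φ x - φ z| ≤ ‖z - x‖ ^ β * (Lφ * ‖z - x‖) := by gcongr
      _ = _ := by ring
  have hgfar : ∀ x, ∀ t > 0, IntegrableOn (fun z => g (x, z)) {z | t ≤ ‖z - x‖} (K x) := by
    intro x t ht
    refine (integrable_and_abs_integral_le (hgx x).aestronglyMeasurable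
      (show 0 ≤ 2 * Mφ by positivity) (by positivity)
      (w := fun z => ‖z - x‖ ^ β) (Filter.Eventually.of_forall fun z => ?_)
      (far_moment_translate (hfar _ (hann x) t ht))).1
    have h1 := hu x z
    rw [norm_sub_rev] at h1
    change |(u x - u z) * (φ x - φ z)| ≤ _
    rw [abs_mul, mul_comm]
    have h2 : |φ x - φ z| ≤ 2 * Mφ := (abs_sub _ _).trans (by linarith [hMφ x, hMφ z])
    gcongr
  have hgK : ∀ x, Integrable (fun z => g (x, z)) (K x) := fun x => by
    rw [← integrableOn_univ, ← union_compl_self {z | τ ≤ ‖z - x‖}]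
    exact (hgfar x τ hτ).union (hgnear x τ hτ).1
  have hkey : ∀ t > 0, Integrable (fun x => ∫ z in {z | t ≤ ‖z - x‖}, g (x, z) ∂(K x)) ∧
      Integrable (fun x => φ x * ∫ z in {z | t ≤ ‖z - x‖}, (u x - u z) ∂(K x)) ∧
      ∫ x, ∫ z in {z | t ≤ ‖z - x‖}, g (x, z) ∂(K x) =
        2 * ∫ x, φ x * ∫ z in {z | t ≤ ‖z - x‖}, (u x - u z) ∂(K x) := by
    intro t ht
    obtain ⟨m, hmswap, hml, hmi⟩ :=
      exists_symmetric_measure hK hsym (far_mass_bound hs hLam hann) ht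
    have hmp : MeasurePreserving Prod.swap m m := ⟨measurable_swap, hmswap⟩
    let F : Euc n × Euc n → ℝ := fun p => φ p.1 * (u p.1 - u p.2)
    have hFc : Continuous F := by fun_prop
    have hF : Integrable F m := by
      refine ⟨hFc.aestronglyMeasurable, ?_⟩
      change ∫⁻ p, ‖F p‖ₑ ∂m < ⊤
      rw [hml _ hFc.enorm.measurable]
      have hb : ∀ x, ∫⁻ z in {z | t ≤ ‖z - x‖}, ‖F (x, z)‖ₑ ∂(K x) ≤
          ‖φ x‖ₑ * ENNReal.ofReal (C₂ * t ^ (β - 2 * s)) := by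
        intro x
        refine le_trans ?_ (mul_le_mul_right (far_moment_translate (hfar _ (hann x) t ht)) _)
        rw [← lintegral_const_mul _ (by fun_prop)]
        refine lintegral_mono fun z => ?_
        change ‖φ x * (u x - u z)‖ₑ ≤ _
        rw [enorm_mul]
        gcongr
        rw [Real.enorm_eq_ofReal_abs, norm_sub_rev]
        exact ENNReal.ofReal_le_ofReal (hu x z)
      refine (lintegral_mono hb).trans_lt ?_
      rw [lintegral_mul_const _ hφc.enorm.measurable]
      exact ENNReal.mul_lt_top hφi.2 ENNReal.ofReal_lt_top
    have hFs : Integrable (F ∘ Prod.swap) m := hmp.integrable_comp_of_integrable hF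
    have hFsi : ∫ p, (F ∘ Prod.swap) p ∂m = ∫ p, F p ∂m :=
      hmp.integral_comp (MeasurableEquiv.prodComm.measurableEmbedding) F
    have hgF : g = F + F ∘ Prod.swap := by
      ext p; simp only [g, F, Pi.add_apply, Function.comp, Prod.fst_swap, Prod.snd_swap]; ring
    have hg : Integrable g m := hgF ▸ hF.add hFs
    have hFe : ∀ x, ∫ z in {z | t ≤ ‖z - x‖}, F (x, z) ∂(K x) =
        φ x * ∫ z in {z | t ≤ ‖z - x‖}, (u x - u z) ∂(K x) := fun x =>
      integral_const_mul (φ x) fun z => u x - u z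
    have h1 := hmi F hF
    simp_rw [hFe] at h1
    refine ⟨(hmi g hg).1, h1.1, ?_⟩
    rw [← (hmi g hg).2, ← h1.2, hgF, two_mul]
    simp only [Pi.add_apply]
    rw [integral_add hF hFs, hFsi]
  have hImeas : AEStronglyMeasurable (fun x => ∫ z, g (x, z) ∂(K x)) volume := by
    refine aestronglyMeasurable_of_tendsto_ae Filter.atTop
      (f := fun (k : ℕ) x => ∫ z in {z | (1 / ((k : ℝ) + 1)) ≤ ‖z - x‖}, g (x, z) ∂(K x))
      (fun k => (hkey _ (by positivity)).1.1) (Filter.Eventually.of_forall fun x => ?_)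
    simp_rw [← integral_indicator (measurableSet_far _ x)]
    refine tendsto_integral_of_dominated_convergence (fun z => |g (x, z)|)
      (fun k => (hgx x).aestronglyMeasurable.indicator (measurableSet_far _ x)) (hgK x).abs
      (fun k => Filter.Eventually.of_forall fun z => ?_) (Filter.Eventually.of_forall fun z => ?_)
    · exact norm_indicator_le_norm_self _ _
    · rcases eq_or_ne z x with rfl | hzx
      · refine tendsto_const_nhds.congr fun k => ?_
        simp [indicator, g]
      · refine tendsto_const_nhds.congr' ?_
        filter_upwards [tendsto_one_div_add_atTop_nhds_zero_nat.eventually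
          (gt_mem_nhds (norm_pos_iff.2 (sub_ne_zero.2 hzx)))] with k hk
        rw [indicator_of_mem (show z ∈ {z | 1 / ((k : ℝ) + 1) ≤ ‖z - x‖} from le_of_lt hk)]
  obtain ⟨hi, hFi, he⟩ := hkey τ hτ
  refine ⟨hFi, ?_⟩
  have hsplit : ∀ x, ∫ z, g (x, z) ∂(K x) = ∫ z in {z | τ ≤ ‖z - x‖}, g (x, z) ∂(K x) +
      ∫ z in {z | τ ≤ ‖z - x‖}ᶜ, g (x, z) ∂(K x) := fun x =>
    (integral_add_compl (measurableSet_far τ x) (hgK x)).symm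
  have hzero : ∀ x, x ∉ ball x₀ (r + τ) → ∫ z in {z | τ ≤ ‖z - x‖}ᶜ, g (x, z) ∂(K x) = 0 := by
    intro x hx
    rw [mem_ball, dist_eq_norm, not_lt] at hx
    refine setIntegral_eq_zero_of_forall_eq_zero fun z hz => ?_
    have hz' : ‖z - x‖ < τ := by simpa using hz
    have h1 : φ x = 0 := hφ0 x (by rw [mem_ball, dist_eq_norm]; linarith)
    have h2 : φ z = 0 := hφ0 z (by
      rw [mem_ball, dist_eq_norm]
      have := norm_sub_le_norm_sub_add_norm_sub x z x₀
      rw [norm_sub_rev x z] at this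
      linarith)
    simp [g, h1, h2]
  have hnm : AEStronglyMeasurable (fun x => ∫ z in {z | τ ≤ ‖z - x‖}ᶜ, g (x, z) ∂(K x))
      volume := by
    have : (fun x => ∫ z in {z | τ ≤ ‖z - x‖}ᶜ, g (x, z) ∂(K x)) =
        fun x => ∫ z, g (x, z) ∂(K x) - ∫ z in {z | τ ≤ ‖z - x‖}, g (x, z) ∂(K x) := by
      ext x; rw [hsplit x]; ring
    rw [this]
    exact hImeas.sub hi.1
  have hni : Integrable fun x => ∫ z in {z | τ ≤ ‖z - x‖}ᶜ, g (x, z) ∂(K x) := by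
    rw [← integrableOn_iff_integrable_of_support_subset (s := ball x₀ (r + τ))
      (fun x hx => by_contra fun h => hx (hzero x h))]
    exact Measure.integrableOn_of_bounded measure_ball_lt_top.ne hnm
      (M := Lφ * (C₁ * τ ^ (1 + β - 2 * s)))
      (Filter.Eventually.of_forall fun x => (hgnear x τ hτ).2)
  have hnb : |∫ x, ∫ z in {z | τ ≤ ‖z - x‖}ᶜ, g (x, z) ∂(K x)| ≤
      Lφ * (C₁ * τ ^ (1 + β - 2 * s)) * (volume (ball x₀ (r + τ))).toReal := by
    rw [← setIntegral_eq_integral_of_forall_compl_eq_zero (s := ball x₀ (r + τ)) hzero]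
    exact norm_setIntegral_le_of_norm_le_const
      (f := fun x => ∫ z in {z | τ ≤ ‖z - x‖}ᶜ, g (x, z) ∂(K x)) measure_ball_lt_top
      fun x _ => (hgnear x τ hτ).2
  have hI : ∫ x, ∫ z, g (x, z) ∂(K x) =
      2 * (∫ x, φ x * ∫ z in {z | τ ≤ ‖z - x‖}, (u x - u z) ∂(K x)) +
      ∫ x, ∫ z in {z | τ ≤ ‖z - x‖}ᶜ, g (x, z) ∂(K x) := by
    rw [← he, ← integral_add hi hni]
    exact integral_congr_ae (Filter.Eventually.of_forall hsplit)
  change |(1 / 2) * (∫ x, ∫ z, g (x, z) ∂(K x)) - _| ≤ _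
  rw [hI]
  have h3 := abs_le.1 hnb
  have h4 := (abs_nonneg _).trans hnb
  rw [abs_le]
  constructor <;> linarith

/-! ### Freezing the kernel at the origin -/

lemma DivElliptic.annulusBound {s lam Lam : ℝ} {K : Euc n → Measure (Euc n)}
    (h : DivElliptic s lam Lam K) (x : Euc n) :
    AnnulusBound s Lam ((K x).map fun z => z - x) := by
  intro r hr
  have hpre : (fun z => z - x) ⁻¹' (ball 0 (2 * r) \ ball 0 r) = ball x (2 * r) \ ball x r := by
    ext z; simp [dist_eq_norm]
  rw [Measure.map_apply (by fun_prop) (measurableSet_ball.diff measurableSet_ball), hpre]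
  have h1 := h.1 x r hr
  have hpos : 0 < r ^ (2 * s) := by positivity
  have h0 : ENNReal.ofReal (r ^ (2 * s)) ≠ 0 := by simpa using hpos
  rw [mul_comm] at h1
  rw [Real.rpow_neg hr.le, ENNReal.ofReal_mul' (by positivity), ENNReal.ofReal_inv_of_pos hpos,
    ← div_eq_mul_inv]
  exact (ENNReal.le_div_iff_mul_le (Or.inl h0) (Or.inl ENNReal.ofReal_ne_top)).2 h1

lemma XReg.tvDiff_le {s η δ : ℝ} {K : Euc n → Measure (Euc n)} (h : XReg s 0 η K) (hη : η ≤ δ)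
    (x : Euc n) {ρ : ℝ} (hρ : 0 < ρ) :
    tvDiff ((K x).map fun z => z - x) (K 0) (ball 0 (2 * ρ) \ ball 0 ρ) ≤
      ENNReal.ofReal (δ * ρ ^ (-(2 * s))) := by
  have h1 := h 0 x ρ hρ
  rw [zero_add, Real.rpow_zero, mul_one] at h1
  exact h1.trans (ENNReal.ofReal_le_ofReal (by gcongr))

lemma AnnulusBound.ne_top {s Lam : ℝ} {ν : Measure (Euc n)} (h : AnnulusBound s Lam ν) {τ : ℝ}
    (hτ : 0 < τ) (J : ℕ) : ν (ball 0 (2 ^ J * τ) \ ball 0 τ) ≠ ⊤ := by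
  induction J with
  | zero => simp
  | succ J ih =>
    have hsub : ball (0 : Euc n) (2 ^ (J + 1) * τ) \ ball 0 τ ⊆
        (ball 0 (2 ^ J * τ) \ ball 0 τ) ∪ (ball 0 (2 * (2 ^ J * τ)) \ ball 0 (2 ^ J * τ)) := by
      intro y hy
      rw [pow_succ, mul_comm (2 ^ J) 2, mul_assoc] at hy
      by_cases h : y ∈ ball (0 : Euc n) (2 ^ J * τ)
      · exact Or.inl ⟨h, hy.2⟩
      · exact Or.inr ⟨hy.1, h⟩
    refine ne_top_of_le_ne_top (ENNReal.add_ne_top.2 ⟨ih, ?_⟩)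
      ((measure_mono hsub).trans (measure_union_le _ _))
    exact ne_top_of_le_ne_top ENNReal.ofReal_ne_top (h _ (by positivity))

lemma abs_shell_integral_sub_le {s Lam δ τ G : ℝ} {μ ν : Measure (Euc n)}
    (hs : 0 < s) (hδ : 0 ≤ δ) (hτ : 0 < τ) (hG0 : 0 ≤ G)
    (hμ : AnnulusBound s Lam μ) (hν : AnnulusBound s Lam ν)
    (htv : ∀ ρ : ℝ, 0 < ρ →
      tvDiff μ ν (ball 0 (2 * ρ) \ ball 0 ρ) ≤ ENNReal.ofReal (δ * ρ ^ (-(2 * s))))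
    {g : Euc n → ℝ} (hg : Measurable g) (J : ℕ)
    (hG : ∀ y ∈ ball (0 : Euc n) (2 ^ J * τ), |g y| ≤ G) :
    |∫ y in ball 0 (2 ^ J * τ) \ ball 0 τ, g y ∂μ -
      ∫ y in ball 0 (2 ^ J * τ) \ ball 0 τ, g y ∂ν| ≤ J * (G * (δ * τ ^ (-(2 * s)))) := by
  induction J with
  | zero => simp
  | succ J ih =>
    have hle : (1 : ℝ) ≤ 2 ^ J := one_le_pow₀ (by norm_num)
    have hR : 0 < 2 ^ J * τ := by positivity
    have h2 : (2 : ℝ) ^ (J + 1) * τ = 2 * (2 ^ J * τ) := by ring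
    rw [h2] at hG ⊢
    have hτR : τ ≤ 2 ^ J * τ := by nlinarith
    have hsplit : ball (0 : Euc n) (2 * (2 ^ J * τ)) \ ball 0 τ =
        (ball 0 (2 ^ J * τ) \ ball 0 τ) ∪ (ball 0 (2 * (2 ^ J * τ)) \ ball 0 (2 ^ J * τ)) := by
      ext y
      simp only [mem_sdiff, mem_union, mem_ball, dist_zero_right, not_lt]
      constructor
      · rintro ⟨h, h'⟩
        rcases lt_or_ge ‖y‖ (2 ^ J * τ) with h3 | h3
        · exact Or.inl ⟨h3, h'⟩
        · exact Or.inr ⟨h, h3⟩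
      · rintro (⟨h, h'⟩ | ⟨h, h'⟩)
        · exact ⟨by linarith, h'⟩
        · exact ⟨h, hτR.trans h'⟩
    have hdisj : Disjoint (ball (0 : Euc n) (2 ^ J * τ) \ ball 0 τ)
        (ball 0 (2 * (2 ^ J * τ)) \ ball 0 (2 ^ J * τ)) :=
      Set.disjoint_left.2 fun y h h' => h'.2 h.1
    have hint : ∀ ξ : Measure (Euc n), AnnulusBound s Lam ξ →
        ∫ y in ball 0 (2 * (2 ^ J * τ)) \ ball 0 τ, g y ∂ξ =
          ∫ y in ball 0 (2 ^ J * τ) \ ball 0 τ, g y ∂ξ +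
          ∫ y in ball 0 (2 * (2 ^ J * τ)) \ ball 0 (2 ^ J * τ), g y ∂ξ := by
      intro ξ hξ
      have hb : ∀ a : ℝ, ∀ b : ℝ, b ≤ 2 * (2 ^ J * τ) → ξ (ball 0 b \ ball 0 a) ≠ ⊤ →
          IntegrableOn g (ball 0 b \ ball 0 a) ξ := fun a b hb hfin =>
        Measure.integrableOn_of_bounded hfin hg.aestronglyMeasurable (M := G)
          ((ae_restrict_iff' (measurableSet_ball.diff measurableSet_ball)).2
            (Filter.Eventually.of_forall fun y hy => hG y (ball_subset_ball hb hy.1)))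
      rw [hsplit]
      exact setIntegral_union hdisj (measurableSet_ball.diff measurableSet_ball)
        (hb _ _ (by linarith) (hξ.ne_top hτ J))
        (hb _ _ le_rfl (ne_top_of_le_ne_top ENNReal.ofReal_ne_top (hξ _ hR)))
    rw [hint μ hμ, hint ν hν]
    have h3 := ih fun y hy => hG y (ball_subset_ball (by linarith) hy)
    have hmA : MeasurableSet (ball (0 : Euc n) (2 * (2 ^ J * τ)) \ ball 0 (2 ^ J * τ)) :=
      measurableSet_ball.diff measurableSet_ball
    have h4 := abs_setIntegral_sub_le_tvDiff μ ν
      (ne_top_of_le_ne_top ENNReal.ofReal_ne_top (hμ _ hR))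
      (ne_top_of_le_ne_top ENNReal.ofReal_ne_top (hν _ hR))
      (hg.indicator hmA) (G := G) (t := δ * (2 ^ J * τ) ^ (-(2 * s)))
      (fun y => by
        by_cases hy : y ∈ ball (0 : Euc n) (2 * (2 ^ J * τ)) \ ball 0 (2 ^ J * τ)
        · rw [indicator_of_mem hy]; exact hG y hy.1
        · rw [indicator_of_notMem hy]; simpa using hG0) (by positivity) (htv _ hR)
    have hind : ∀ ξ : Measure (Euc n),
        ∫ y in ball 0 (2 * (2 ^ J * τ)) \ ball 0 (2 ^ J * τ),
          (ball (0 : Euc n) (2 * (2 ^ J * τ)) \ ball 0 (2 ^ J * τ)).indicator g y ∂ξ =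
        ∫ y in ball 0 (2 * (2 ^ J * τ)) \ ball 0 (2 ^ J * τ), g y ∂ξ := fun ξ =>
      setIntegral_congr_fun hmA fun y hy => indicator_of_mem hy g
    rw [hind, hind] at h4
    have h5 : (2 ^ J * τ) ^ (-(2 * s)) ≤ τ ^ (-(2 * s)) :=
      Real.rpow_le_rpow_of_nonpos hτ hτR (by linarith)
    have h6 : G * (δ * (2 ^ J * τ) ^ (-(2 * s))) ≤ G * (δ * τ ^ (-(2 * s))) := by gcongr
    push_cast
    rw [abs_le] at *
    constructor <;> nlinarith [h3.1, h3.2, h4.1, h4.2]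

/-- Hölder's inequality for a source term tested with a bounded function supported in a ball. -/
lemma abs_integral_mul_le_of_eLpNorm_le {f φ : Euc n → ℝ} {q δ M r : ℝ} (hq : 1 ≤ q) (hδ : 0 ≤ δ)
    {Ω : Set (Euc n)} {x : Euc n} (hf : eLpNorm f (ENNReal.ofReal q) (volume.restrict Ω) ≤
      ENNReal.ofReal δ) (hsub : ball x r ⊆ Ω) (hφ0 : ∀ w, w ∉ ball x r → φ w = 0)
    (hφ : ∀ w, |φ w| ≤ M) :
    |∫ w, f w * φ w| ≤ M * δ * (1 + (volume (ball x r)).toReal) := by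
  have hM : 0 ≤ M := (abs_nonneg _).trans (hφ 0)
  by_cases hint : Integrable fun w => f w * φ w
  swap
  · rw [integral_undef hint, abs_zero]; positivity
  have hsupp : ∀ w, w ∉ ball x r → f w * φ w = 0 := fun w hw => by rw [hφ0 w hw, mul_zero]
  rw [← setIntegral_eq_integral_of_forall_compl_eq_zero hsupp]
  have h1 := enorm_integral_le_lintegral_enorm (μ := volume.restrict (ball x r))
    (fun w => f w * φ w)
  rw [← eLpNorm_one_eq_lintegral_enorm, Real.enorm_eq_ofReal_abs] at h1
  have hq1 : (1 : ℝ≥0∞) ≤ ENNReal.ofReal q := by simpa using hq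
  have h2 := eLpNorm_le_eLpNorm_mul_rpow_measure_univ (μ := volume.restrict (ball x r)) hq1
    hint.1.restrict
  have h3 : eLpNorm (fun w => f w * φ w) (ENNReal.ofReal q) (volume.restrict (ball x r)) ≤
      ENNReal.ofReal (M * δ) := by
    have h4 := eLpNorm_le_mul_eLpNorm_of_ae_le_mul (f := fun w => f w * φ w) (g := f) (c := M)
      (μ := volume.restrict (ball x r)) (Filter.Eventually.of_forall fun w => by
        rw [norm_mul, mul_comm, Real.norm_eq_abs (φ w)]
        gcongr
        exact hφ w) (ENNReal.ofReal q)
    rw [ENNReal.ofReal_mul hM]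
    refine h4.trans ?_
    gcongr
    exact (eLpNorm_mono_measure _ (Measure.restrict_mono hsub le_rfl)).trans hf
  have hv : volume (ball x r) = ENNReal.ofReal (volume (ball x r)).toReal :=
    (ENNReal.ofReal_toReal measure_ball_lt_top.ne).symm
  set V := (volume (ball x r)).toReal
  have hV : 0 ≤ V := ENNReal.toReal_nonneg
  have h5 : ((volume.restrict (ball x r)) univ) ^
      (1 / (1 : ℝ≥0∞).toReal - 1 / (ENNReal.ofReal q).toReal) ≤ ENNReal.ofReal (1 + V) := by
    rw [Measure.restrict_apply_univ, hv, ENNReal.toReal_one, ENNReal.toReal_ofReal (by linarith)]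
    have hq' : 1 / q ≤ 1 := by rw [div_le_one (by linarith)]; exact hq
    have hq'' : 0 ≤ 1 / q := by positivity
    rw [ENNReal.ofReal_rpow_of_nonneg hV (by linarith)]
    refine ENNReal.ofReal_le_ofReal ?_
    calc V ^ (1 / 1 - 1 / q) ≤ (1 + V) ^ (1 / 1 - 1 / q) :=
          Real.rpow_le_rpow hV (by linarith) (by linarith)
      _ ≤ (1 + V) ^ (1 : ℝ) := Real.rpow_le_rpow_of_exponent_le (by linarith) (by linarith)
      _ = _ := Real.rpow_one _
  have h6 := h1.trans (h2.trans (mul_le_mul' h3 h5))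
  rw [← ENNReal.ofReal_mul (by positivity), ENNReal.ofReal_le_ofReal_iff (by positivity)] at h6
  exact h6

lemma abs_shell_integral_mollify_le {s Lam β C₁ C₂ δ q : ℝ} (hs : 0 < s) (hLam : 0 ≤ Lam)
    (hβ : 0 < β) (hC₁ : 0 ≤ C₁) (hC₂ : 0 ≤ C₂) (hq : 1 ≤ q) (hδ : 0 < δ)
    (hnear : ∀ ν : Measure (Euc n), AnnulusBound s Lam ν → ∀ τ : ℝ, 0 < τ →
      ∫⁻ y in ball 0 τ, ENNReal.ofReal (‖y‖ ^ (1 + β)) ∂ν ≤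
        ENNReal.ofReal (C₁ * τ ^ (1 + β - 2 * s)))
    (hfar : ∀ ν : Measure (Euc n), AnnulusBound s Lam ν → ∀ τ : ℝ, 0 < τ →
      ∫⁻ y in (ball 0 τ)ᶜ, ENNReal.ofReal (‖y‖ ^ β) ∂ν ≤ ENNReal.ofReal (C₂ * τ ^ (β - 2 * s)))
    {K : Euc n → Measure (Euc n)} (hK : MeasKernel K) (hsym : DivSymmetric K)
    (hann : ∀ x, AnnulusBound s Lam ((K x).map fun z => z - x))
    (htv : ∀ x, ∀ ρ : ℝ, 0 < ρ →
      tvDiff ((K x).map fun z => z - x) (K 0) (ball 0 (2 * ρ) \ ball 0 ρ) ≤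
        ENNReal.ofReal (δ * ρ ^ (-(2 * s))))
    {u f : Euc n → ℝ} (huc : Continuous u) (hu : ∀ x y, |u x - u y| ≤ ‖x - y‖ ^ β)
    (hf : eLpNorm f (ENNReal.ofReal q) (volume.restrict (ball 0 (1 / δ))) ≤ ENNReal.ofReal δ)
    (hw : WeakSol K u f (ball 0 (1 / δ)))
    {φ : Euc n → ℝ} (hφc : ContDiff ℝ (⊤ : ℕ∞) φ) {r : ℝ} (hr1 : r ≤ 1)
    (hφ0 : ∀ w, w ∉ ball 0 r → φ w = 0) (hφp : ∀ w, 0 ≤ φ w) (hφ1 : ∫ w, φ w = 1)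
    {Lφ Mφ : ℝ} (hLφ : 0 ≤ Lφ) (hMφ : ∀ w, |φ w| ≤ Mφ)
    (hφL : ∀ x y, |φ x - φ y| ≤ Lφ * ‖x - y‖) {τ : ℝ} (hτ : 0 < τ) (hτ1 : τ ≤ 1) (J : ℕ)
    {x : Euc n} (hx : ‖x‖ + 1 < 1 / δ) :
    |∫ y in ball 0 (2 ^ J * τ) \ ball 0 τ,
        ((∫ w, φ w * u (x + w)) - ∫ w, φ w * u (x + y + w)) ∂(K 0)| ≤
      Lφ * (C₁ * τ ^ (1 + β - 2 * s)) * (volume (ball (0 : Euc n) 2)).toReal +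
        C₂ * (2 ^ J * τ) ^ (β - 2 * s) + J * ((2 ^ J * τ) ^ β * (δ * τ ^ (-(2 * s)))) +
        Mφ * δ * (1 + (volume (ball (0 : Euc n) 2)).toReal) := by
  have hM0 : 0 ≤ Mφ := (abs_nonneg _).trans (hMφ 0)
  set R := 2 ^ J * τ with hRdef
  have hR : 0 < R := by positivity
  have hτR : τ ≤ R := le_mul_of_one_le_left hτ.le (one_le_pow₀ (by norm_num))
  set V := (volume (ball (0 : Euc n) 2)).toReal with hV
  have hVle : ∀ z : Euc n, ∀ t ≤ 2, (volume (ball z t)).toReal ≤ V := fun z t ht => by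
    rw [Measure.addHaar_ball_center]
    exact ENNReal.toReal_mono measure_ball_lt_top.ne (measure_mono (ball_subset_ball ht))
  set S : Set (Euc n) := ball 0 R \ ball 0 τ with hS
  have hSm : MeasurableSet S := measurableSet_ball.diff measurableSet_ball
  have hann0 : AnnulusBound s Lam (K 0) := by simpa using hann 0
  have hSfin : K 0 S ≠ ⊤ := hann0.ne_top hτ J
  have : IsFiniteMeasure ((K 0).restrict S) := ⟨by simpa using hSfin.lt_top⟩
  let ψ : Euc n → ℝ := fun w => φ (w - x)
  have hψc : ContDiff ℝ (⊤ : ℕ∞) ψ := hφc.comp (contDiff_id.sub contDiff_const)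
  have hψ0 : ∀ w, w ∉ ball x r → ψ w = 0 := fun w hw =>
    hφ0 _ fun h => hw (by simpa [dist_eq_norm] using h)
  have hψsupp : tsupport ψ ⊆ closedBall x r :=
    closure_minimal (fun w hw => by_contra fun h =>
      hw (hψ0 w fun h' => h (ball_subset_closedBall h'))) isClosed_closedBall
  have hψcs : HasCompactSupport ψ := (isCompact_closedBall x r).of_isClosed_subset
    (isClosed_tsupport _) hψsupp
  have hψi : Integrable ψ := hψc.continuous.integrable_of_hasCompactSupport hψcs
  have hψ1 : ∫ w, ψ w = 1 := by rw [← hφ1]; exact integral_sub_right_eq_self φ x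
  have hsub : closedBall x r ⊆ ball 0 (1 / δ) := fun w hw => by
    rw [mem_closedBall, dist_eq_norm] at hw
    rw [mem_ball_zero_iff]
    have := norm_add_le (w - x) x
    rw [sub_add_cancel] at this
    linarith
  have hweak := hw.2.2 ψ hψc hψcs (hψsupp.trans hsub)
  obtain ⟨hTi, hT⟩ := weak_form_truncated hs hLam hβ hC₁ hC₂ hnear hfar hK hsym hann huc hu
    hψc.continuous hψ0 hLφ (fun w => hMφ _) (fun a b => by simpa using hφL (a - x) (b - x)) hτ
  rw [hweak] at hT
  have hfψ := abs_integral_mul_le_of_eLpNorm_le hq hδ.le hf (ball_subset_closedBall.trans hsub) hψ0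
    (fun w => hMφ _)
  have hfar' : ∀ w, |∫ z in {z | τ ≤ ‖z - w‖}, (u w - u z) ∂(K w) -
      ∫ y in S, (u w - u (w + y)) ∂(K 0)| ≤
        C₂ * R ^ (β - 2 * s) + J * (R ^ β * (δ * τ ^ (-(2 * s)))) := by
    intro w
    set ν := (K w).map fun z => z - w
    have hgc : Continuous fun y => u w - u (w + y) := by fun_prop
    have hbd : ∀ y, |u w - u (w + y)| ≤ ‖y‖ ^ β := fun y => by
      simpa using hu w (w + y)
    have h1 : ∫ z in {z | τ ≤ ‖z - w‖}, (u w - u z) ∂(K w) =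
        ∫ y in (ball 0 τ)ᶜ, (u w - u (w + y)) ∂ν := by
      rw [setIntegral_map measurableSet_ball.compl hgc.aestronglyMeasurable (by fun_prop)]
      have : (fun z => z - w) ⁻¹' (ball 0 τ)ᶜ = {z | τ ≤ ‖z - w‖} := by ext; simp
      rw [this]
      simp
    have hfi := fun t (ht : 0 < t) => integrable_and_abs_integral_le
      (μ := ν.restrict (ball 0 t)ᶜ) hgc.aestronglyMeasurable
      zero_le_one (by positivity) (w := fun y => ‖y‖ ^ β)
      (Filter.Eventually.of_forall fun y => by simpa using hbd y) (hfar ν (hann w) t ht)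
    have h2 : (ball (0 : Euc n) τ)ᶜ = S ∪ (ball 0 R)ᶜ := by
      ext y
      simp only [hS, mem_compl_iff, mem_union, mem_sdiff, mem_ball, dist_zero_right, not_lt]
      constructor
      · intro h
        rcases lt_or_ge ‖y‖ R with h' | h'
        · exact Or.inl ⟨h', h⟩
        · exact Or.inr h'
      · rintro (h | h)
        · exact h.2
        · exact hτR.trans h
    have h3 : ∫ y in (ball 0 τ)ᶜ, (u w - u (w + y)) ∂ν =
        ∫ y in S, (u w - u (w + y)) ∂ν + ∫ y in (ball 0 R)ᶜ, (u w - u (w + y)) ∂ν := by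
      rw [h2]
      refine setIntegral_union (Set.disjoint_left.2 fun y h h' => h' h.1)
        measurableSet_ball.compl ?_ (hfi R hR).1
      exact IntegrableOn.mono_set (hfi τ hτ).1 (h2 ▸ subset_union_left)
    have h4 := (hfi R hR).2
    have h5 := abs_shell_integral_sub_le (G := R ^ β) hs hδ.le hτ (by positivity) (hann w) hann0
      (htv w) hgc.measurable J (fun y hy => (hbd y).trans (by
        have : ‖y‖ < R := by simpa using hy
        gcongr))
    rw [h1, h3]
    rw [abs_le] at *
    constructor <;> linarith [h4.1, h4.2, h5.1, h5.2]
  let F : Euc n × Euc n → ℝ := fun p => ψ p.1 * (u p.1 - u (p.1 + p.2))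
  have hFc : Continuous F := by have := hψc.continuous; fun_prop
  have hFi : Integrable F ((volume : Measure (Euc n)).prod ((K 0).restrict S)) := by
    have hd : Integrable (fun p : Euc n × Euc n => ψ p.1 * R ^ β)
        ((volume : Measure (Euc n)).prod ((K 0).restrict S)) :=
      hψi.mul_prod (integrable_const (R ^ β))
    refine hd.mono hFc.aestronglyMeasurable ?_
    have hae : ∀ᵐ p ∂((volume : Measure (Euc n)).prod ((K 0).restrict S)), p.2 ∈ S :=
      Measure.quasiMeasurePreserving_snd.ae (ae_restrict_mem hSm)
    filter_upwards [hae] with p hp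
    simp only [F, norm_mul]
    gcongr
    have h1 := hu p.1 (p.1 + p.2)
    have h2 : ‖p.2‖ < R := by simpa using hp.1
    rw [Real.norm_eq_abs, Real.norm_eq_abs, abs_of_nonneg (a := R ^ β) (by positivity)]
    refine h1.trans ?_
    simp only [sub_add_cancel_left, norm_neg]
    gcongr
  have hFl := hFi.integral_prod_left
  have hFe : ∀ w, ∫ y in S, F (w, y) ∂(K 0) = ψ w * ∫ y in S, (u w - u (w + y)) ∂(K 0) :=
    fun w => integral_const_mul (ψ w) fun y => u w - u (w + y)
  have hmol : ∀ y, Integrable (fun w => ψ w * u (w + y)) := fun y =>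
    (hψc.continuous.mul (by fun_prop)).integrable_of_hasCompactSupport hψcs.mul_right
  have hshift : ∀ y, ∫ w, ψ w * u (w + y) = ∫ w, φ w * u (x + y + w) := fun y => by
    rw [← integral_add_right_eq_self _ x]
    refine integral_congr_ae (Filter.Eventually.of_forall fun w => ?_)
    simp only [ψ, add_sub_cancel_right]
    congr 2
    abel
  have hswap : ∫ w, ψ w * ∫ y in S, (u w - u (w + y)) ∂(K 0) =
      ∫ y in S, ((∫ w, φ w * u (x + w)) - ∫ w, φ w * u (x + y + w)) ∂(K 0) := by
    simp_rw [← hFe]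
    rw [integral_integral_swap hFi]
    refine integral_congr_ae (Filter.Eventually.of_forall fun y => ?_)
    simp only [F, mul_sub]
    have h0 := hmol 0
    have h0' := hshift 0
    simp only [add_zero] at h0 h0'
    rw [integral_sub h0 (hmol y), h0', hshift]
  have hdiff : |(∫ w, ψ w * ∫ z in {z | τ ≤ ‖z - w‖}, (u w - u z) ∂(K w)) -
      ∫ w, ψ w * ∫ y in S, (u w - u (w + y)) ∂(K 0)| ≤
        C₂ * R ^ (β - 2 * s) + J * (R ^ β * (δ * τ ^ (-(2 * s)))) := by
    simp_rw [hFe] at hFl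
    rw [← integral_sub hTi hFl]
    have := norm_integral_le_of_norm_le
      (hψi.mul_const (C₂ * R ^ (β - 2 * s) + J * (R ^ β * (δ * τ ^ (-(2 * s))))))
      (f := fun w => ψ w * (∫ z in {z | τ ≤ ‖z - w‖}, (u w - u z) ∂(K w)) -
        ψ w * ∫ y in S, (u w - u (w + y)) ∂(K 0)) (Filter.Eventually.of_forall fun w => by
        rw [← mul_sub, norm_mul, Real.norm_of_nonneg (hφp (w - x))]
        exact mul_le_mul_of_nonneg_left (hfar' w) (hφp _))
    rwa [integral_mul_const, hψ1, one_mul] at this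
  rw [hswap] at hdiff
  have hv1 := hVle x r (by linarith)
  have hv2 := hVle x (r + τ) (by linarith)
  have hb1 : Lφ * (C₁ * τ ^ (1 + β - 2 * s)) * (volume (ball x (r + τ))).toReal ≤
      Lφ * (C₁ * τ ^ (1 + β - 2 * s)) * V := by gcongr
  have hb2 : Mφ * δ * (1 + (volume (ball x r)).toReal) ≤ Mφ * δ * (1 + V) := by gcongr
  rw [abs_le] at *
  constructor <;> linarith [hT.1, hT.2, hdiff.1, hdiff.2, hfψ.1, hfψ.2]

/-! ### Almost harmonic functions for a random walk are almost invariant under its jumps -/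

lemma sq_integral_le_integral_sq {α : Type*} [MeasurableSpace α] {π : Measure α}
    [IsProbabilityMeasure π] {g : α → ℝ} (hg : Integrable g π)
    (hg2 : Integrable (fun x => g x ^ 2) π) : (∫ x, g x ∂π) ^ 2 ≤ ∫ x, g x ^ 2 ∂π := by
  set a := ∫ x, g x ∂π with ha
  have h0 : 0 ≤ ∫ x, (g x - a) ^ 2 ∂π := integral_nonneg fun x => sq_nonneg _
  have h1 : ∫ x, (g x - a) ^ 2 ∂π = ∫ x, (g x ^ 2 - 2 * a * g x + a ^ 2) ∂π := by
    congr 1; ext x; ring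
  have h2 : Integrable (fun x => g x ^ 2 - 2 * a * g x) π := hg2.sub (hg.const_mul _)
  rw [h1, integral_add h2 (integrable_const _),
    integral_sub hg2 (hg.const_mul _), integral_const_mul, ← ha] at h0
  simp only [integral_const, probReal_univ, one_smul] at h0
  nlinarith

lemma walk_variance_step {μ π : Measure (Euc n)} [IsProbabilityMeasure μ] [IsProbabilityMeasure π]
    {B ω e : ℝ} {v : Euc n → ℝ} (hvc : Continuous v) (hvB : ∀ x, |v x| ≤ B)
    (hω : ∀ᵐ z ∂π, |∫ y, v (z + y) ∂μ - v z| ≤ ω) {S : Set (Euc n)} (hS : MeasurableSet S)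
    (he : ∀ w ∈ S, |∫ z, v (z + w) ∂π - v w| ≤ e) (he0 : |∫ z, v z ∂π - v 0| ≤ e) :
    ∫ z, v z ^ 2 ∂π + ∫ y in S, (v y - v 0) ^ 2 ∂μ - 2 * B * ω - 8 * B * e * (μ S).toReal ≤
      ∫ z, ∫ y, v (z + y) ^ 2 ∂μ ∂π := by
  have hB : 0 ≤ B := (abs_nonneg _).trans (hvB 0)
  have hint : ∀ {α : Type} [MeasurableSpace α] [TopologicalSpace α] [BorelSpace α]
      [SecondCountableTopology α] (ξ : Measure α) [IsFiniteMeasure ξ] {g : α → ℝ} {C : ℝ},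
      Continuous g → (∀ x, |g x| ≤ C) → Integrable g ξ := by
    intro α _ _ _ _ ξ _ g C hg hC
    exact Integrable.of_bound hg.aestronglyMeasurable C (Filter.Eventually.of_forall hC)
  have hv2 : ∀ x, |v x ^ 2| ≤ B ^ 2 := fun x => by
    rw [abs_pow]; exact pow_le_pow_left₀ (abs_nonneg _) (hvB x) 2
  have hd : ∀ x y, |v x - v y| ≤ 2 * B := fun x y => by
    have h1 := abs_le.1 (hvB x)
    have h2 := abs_le.1 (hvB y)
    rw [abs_le]; constructor <;> linarith
  have hd2 : ∀ x y, |(v x - v y) ^ 2| ≤ (2 * B) ^ 2 := fun x y => by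
    rw [abs_pow]; exact pow_le_pow_left₀ (abs_nonneg _) (hd x y) 2
  have hi1 : ∀ z, Integrable (fun y => v (z + y)) μ := fun z =>
    hint μ (by fun_prop) (fun y => hvB _)
  have hi2 : ∀ z, Integrable (fun y => (v (z + y) - v z) ^ 2) μ := fun z =>
    hint μ (by fun_prop) (fun y => hd2 _ _)
  have hF : Integrable (fun p : Euc n × Euc n => (v (p.1 + p.2) - v p.1) ^ 2)
      (π.prod (μ.restrict S)) := hint _ (by fun_prop) (fun p => hd2 _ _)
  have hF2 : Integrable (fun p : Euc n × Euc n => v (p.1 + p.2) ^ 2)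
      (π.prod μ) := hint _ (by fun_prop) (fun p => hv2 _)
  have hv2i : Integrable (fun z => v z ^ 2) π := hint π (by fun_prop) (fun y => hv2 _)
  have hpt : ∀ᵐ z ∂π, v z ^ 2 - 2 * B * ω + ∫ y in S, (v (z + y) - v z) ^ 2 ∂μ ≤
      ∫ y, v (z + y) ^ 2 ∂μ := by
    filter_upwards [hω] with z hz
    have h1 : ∫ y, v (z + y) ^ 2 ∂μ =
        ∫ y, (v (z + y) - v z) ^ 2 ∂μ + 2 * v z * ∫ y, v (z + y) ∂μ - v z ^ 2 := by
      have : ∀ y, v (z + y) ^ 2 = (v (z + y) - v z) ^ 2 + 2 * v z * v (z + y) - v z ^ 2 :=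
        fun y => by ring
      simp_rw [this]
      have hi : Integrable (fun y => (v (z + y) - v z) ^ 2 + 2 * v z * v (z + y)) μ :=
        (hi2 z).add ((hi1 z).const_mul _)
      rw [integral_sub hi (integrable_const _),
        integral_add (hi2 z) ((hi1 z).const_mul _), integral_const_mul]
      simp
    have h2 : ∫ y in S, (v (z + y) - v z) ^ 2 ∂μ ≤ ∫ y, (v (z + y) - v z) ^ 2 ∂μ :=
      setIntegral_le_integral (hi2 z) (Filter.Eventually.of_forall fun y => sq_nonneg _)
    have h3 : |v z * (∫ y, v (z + y) ∂μ - v z)| ≤ B * ω := by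
      rw [abs_mul]; gcongr; exact hvB z
    have h4 := (abs_le.1 h3).1
    rw [h1]
    nlinarith
  have hi5 : Integrable (fun z => v z ^ 2 - 2 * B * ω) π := hv2i.sub (integrable_const _)
  have hF1 : Integrable (fun z => ∫ y in S, (v (z + y) - v z) ^ 2 ∂μ) π := hF.integral_prod_left
  have hL : ∫ z, (v z ^ 2 - 2 * B * ω + ∫ y in S, (v (z + y) - v z) ^ 2 ∂μ) ∂π ≤
      ∫ z, ∫ y, v (z + y) ^ 2 ∂μ ∂π :=
    integral_mono_ae (hi5.add hF1) hF2.integral_prod_left hpt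
  rw [integral_add hi5 hF1,
    integral_sub hv2i (integrable_const _), integral_integral_swap hF] at hL
  have hS2 : ∫ y in S, ((v y - v 0) ^ 2 - 8 * B * e) ∂μ ≤
      ∫ y in S, ∫ z, (v (z + y) - v z) ^ 2 ∂π ∂μ := by
    have hq : Integrable (fun y => (v y - v 0) ^ 2) (μ.restrict S) :=
      hint _ (by fun_prop) (fun p => hd2 _ _)
    refine setIntegral_mono_on (hq.sub (integrable_const _)) hF.integral_prod_right hS ?_
    intro y hy
    have hi3 : Integrable (fun z => v (z + y)) π := hint π (by fun_prop) (fun y => hvB _)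
    have hi4 : Integrable v π := hint π hvc hvB
    have hJ := sq_integral_le_integral_sq (π := π) (g := fun z => v (z + y) - v z) (hi3.sub hi4)
      (hint π (by fun_prop) (fun p => hd2 _ _))
    rw [integral_sub hi3 hi4] at hJ
    refine le_trans ?_ hJ
    have h1 := abs_le.1 (he y hy)
    have h2 := abs_le.1 he0
    set a := ∫ z, v (z + y) ∂π - ∫ z, v z ∂π with ha
    have h3 : |a - (v y - v 0)| ≤ 2 * e := by
      rw [abs_le]; constructor <;> linarith [h1.1, h1.2, h2.1, h2.2]
    have h5 : |(v y - v 0) * (a - (v y - v 0))| ≤ 2 * B * (2 * e) := by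
      rw [abs_mul]; gcongr; exact hd y 0
    nlinarith [(abs_le.1 h5).1, sq_nonneg (a - (v y - v 0))]
  have hq : Integrable (fun y => (v y - v 0) ^ 2) (μ.restrict S) :=
    hint _ (by fun_prop) (fun p => hd2 _ _)
  rw [integral_sub hq (integrable_const _)] at hS2
  simp only [integral_const, smul_eq_mul, measureReal_def, measure_univ, ENNReal.toReal_one,
    Measure.restrict_apply_univ] at hL hS2
  linarith

lemma walk_variance {μ : Measure (Euc n)} [IsProbabilityMeasure μ] {R₀ R₁ B ω : ℝ}
    (hR₀ : 0 ≤ R₀) (hR₁ : 0 ≤ R₁) (hω0 : 0 ≤ ω) (hsupp : ∀ᵐ y ∂μ, ‖y‖ ≤ R₀) {v : Euc n → ℝ}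
    (hvc : Continuous v) (hvB : ∀ x, |v x| ≤ B) (N : ℕ)
    (hω : ∀ x, ‖x‖ ≤ N * R₀ + R₁ → |∫ y, v (x + y) ∂μ - v x| ≤ ω) {S : Set (Euc n)}
    (hS : MeasurableSet S) (hSR : ∀ y ∈ S, ‖y‖ ≤ R₁) :
    N * ∫ y in S, (v y - v 0) ^ 2 ∂μ ≤ B ^ 2 + N * (2 * B * ω + 8 * B * (N * ω) * (μ S).toReal) := by
  have hB : 0 ≤ B := (abs_nonneg _).trans (hvB 0)
  have key : ∀ k : ℕ, k ≤ N → ∃ π : Measure (Euc n), IsProbabilityMeasure π ∧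
      (∀ᵐ z ∂π, ‖z‖ ≤ k * R₀) ∧ (∀ w, ‖w‖ ≤ R₁ → |∫ z, v (z + w) ∂π - v w| ≤ k * ω) ∧
      k * (∫ y in S, (v y - v 0) ^ 2 ∂μ - (2 * B * ω + 8 * B * (N * ω) * (μ S).toReal)) ≤
        ∫ z, v z ^ 2 ∂π := by
    intro k
    induction k with
    | zero =>
      refine fun _ => ⟨Measure.dirac 0, inferInstance, ?_, ?_, ?_⟩
      · rw [ae_dirac_eq]; simp
      · intro w _; simp
      · simp [sq_nonneg]
    | succ k ih =>
      intro hk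
      obtain ⟨π, hπ, h1, h2, h3⟩ := ih (by omega)
      have hkN : (k : ℝ) + 1 ≤ N := by exact_mod_cast hk
      have hint : ∀ {g : Euc n → ℝ} {C : ℝ}, Continuous g → (∀ x, |g x| ≤ C) →
          ∀ ξ : Measure (Euc n), IsFiniteMeasure ξ → Integrable g ξ := by
        intro g C hg hC ξ _
        exact Integrable.of_bound hg.aestronglyMeasurable C (Filter.Eventually.of_forall hC)
      have hv2 : ∀ x, |v x ^ 2| ≤ B ^ 2 := fun x => by
        rw [abs_pow]; exact pow_le_pow_left₀ (abs_nonneg _) (hvB x) 2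
      refine ⟨π.conv μ, inferInstance, ?_, ?_, ?_⟩
      · unfold Measure.conv
        rw [ae_map_iff (by fun_prop) (measurableSet_le (by fun_prop) (by fun_prop))]
        filter_upwards [Measure.quasiMeasurePreserving_fst.ae h1,
          Measure.quasiMeasurePreserving_snd.ae hsupp] with p hp1 hp2
        refine (norm_add_le _ _).trans ?_
        push_cast
        linarith
      · intro w hw
        rw [integral_conv (hint (by fun_prop) (fun x => hvB _) _ inferInstance)]
        have hpt : ∀ᵐ z ∂π, ‖∫ y, v (z + y + w) ∂μ - v (z + w)‖ ≤ ω := by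
          filter_upwards [h1] with z hz
          have := hω (z + w) ((norm_add_le _ _).trans (by nlinarith))
          simpa [add_right_comm] using this
        have hI : Integrable (fun z => ∫ y, v (z + y + w) ∂μ) π := by
          refine Integrable.integral_prod_left
            (f := fun p : Euc n × Euc n => v (p.1 + p.2 + w)) (ν := μ) ?_
          exact Integrable.of_bound (by fun_prop : Continuous _).aestronglyMeasurable B
            (Filter.Eventually.of_forall fun p => hvB _)
        have h4 := norm_integral_le_of_norm_le_const hpt
        rw [integral_sub hI (hint (by fun_prop) (fun x => hvB _) _ inferInstance), probReal_univ,
          mul_one, Real.norm_eq_abs] at h4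
        have h5 := h2 w hw
        push_cast
        rw [abs_le] at *
        constructor <;> linarith [h4.1, h4.2, h5.1, h5.2]
      · rw [integral_conv (hint (by fun_prop) hv2 _ inferInstance)]
        have hpt : ∀ᵐ z ∂π, |∫ y, v (z + y) ∂μ - v z| ≤ ω := by
          filter_upwards [h1] with z hz
          exact hω z (by nlinarith)
        have h5 := h2 0 (by simpa using hR₁)
        simp only [add_zero] at h5
        have h6 : (k : ℝ) * ω ≤ N * ω := by gcongr; linarith
        have h4 := walk_variance_step (e := N * ω) hvc hvB hpt hS
          (fun w hw => (h2 w (hSR w hw)).trans h6) (h5.trans h6)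
        push_cast
        linarith
  obtain ⟨π, hπ, -, -, h⟩ := key N le_rfl
  have h1 : ∫ z, v z ^ 2 ∂π ≤ B ^ 2 := by
    have := norm_integral_le_of_norm_le_const (μ := π) (f := fun z => v z ^ 2) (C := B ^ 2)
      (Filter.Eventually.of_forall fun z => by
        rw [norm_pow]; exact pow_le_pow_left₀ (norm_nonneg _) (hvB z) 2)
    rw [probReal_univ, mul_one] at this
    exact (le_abs_self _).trans this
  linarith

lemma setIntegral_sq_increment_le {ν : Measure (Euc n)} [IsFiniteMeasure ν] {R₀ R₁ B ω T R : ℝ}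
    (hR₀ : 0 ≤ R₀) (hR₁ : 0 ≤ R₁) (hω0 : 0 ≤ ω) (hT : 0 < T) (hsupp : ∀ᵐ y ∂ν, ‖y‖ ≤ R₀)
    {v : Euc n → ℝ} (hvc : Continuous v) (hvB : ∀ x, |v x| ≤ B)
    (hR : (T * (ν univ).toReal + 1) * R₀ + R₁ ≤ R)
    (hω : ∀ x, ‖x‖ ≤ R → |∫ y, (v x - v (x + y)) ∂ν| ≤ ω) {S : Set (Euc n)}
    (hS : MeasurableSet S) (hSR : ∀ y ∈ S, ‖y‖ ≤ R₁) :
    ∫ y in S, (v y - v 0) ^ 2 ∂ν ≤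
      B ^ 2 / T + 2 * B * ω + 8 * B * ω * (T * (ν S).toReal + 1) := by
  have hB : 0 ≤ B := (abs_nonneg _).trans (hvB 0)
  rcases eq_or_ne ν 0 with rfl | hν
  · simp only [Measure.restrict_zero, integral_zero_measure]
    positivity
  have : NeZero ν := ⟨hν⟩
  set m := (ν univ).toReal with hm
  have hm0 : 0 < m := ENNReal.toReal_pos (Measure.measure_univ_ne_zero.2 hν) (measure_ne_top _ _)
  have hminv : ((ν univ)⁻¹).toReal = m⁻¹ := ENNReal.toReal_inv _
  set μ := (ν univ)⁻¹ • ν with hμ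
  have hμS : (μ S).toReal = m⁻¹ * (ν S).toReal := by
    rw [hμ, Measure.smul_apply, smul_eq_mul, ENNReal.toReal_mul, hminv]
  have hμI : ∀ g : Euc n → ℝ, ∫ y, g y ∂μ = m⁻¹ * ∫ y, g y ∂ν := fun g => by
    rw [hμ, integral_smul_measure, hminv, smul_eq_mul]
  have hμIS : ∀ g : Euc n → ℝ, ∫ y in S, g y ∂μ = m⁻¹ * ∫ y in S, g y ∂ν := fun g => by
    rw [hμ, Measure.restrict_smul, integral_smul_measure, hminv, smul_eq_mul]
  set N := ⌈T * m⌉₊ with hN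
  have hN1 : T * m ≤ N := Nat.le_ceil _
  have hN2 : (N : ℝ) < T * m + 1 := Nat.ceil_lt_add_one (by positivity)
  have hN0 : (0 : ℝ) < N := lt_of_lt_of_le (by positivity) hN1
  have hW := walk_variance (μ := μ) hR₀ hR₁ (show 0 ≤ ω / m by positivity)
    (Measure.ae_smul_measure hsupp _) hvc hvB N (fun x hx => by
      have h1 := hω x (hx.trans (le_trans (by gcongr) hR))
      have hi : Integrable (fun y => v (x + y)) ν :=
        Integrable.of_bound (by fun_prop) B (Filter.Eventually.of_forall fun y => hvB _)
      rw [integral_sub (integrable_const _) hi, integral_const, smul_eq_mul, measureReal_def,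
        ← hm] at h1
      have h2 : m⁻¹ * ∫ y, v (x + y) ∂ν - v x = (m * v x - ∫ y, v (x + y) ∂ν) * (-m⁻¹) := by
        field_simp
        ring
      rw [hμI, h2, abs_mul, abs_neg, abs_of_pos (inv_pos.2 hm0), ← div_eq_mul_inv]
      gcongr) hS hSR
  rw [hμIS, hμS] at hW
  set I := ∫ y in S, (v y - v 0) ^ 2 ∂ν
  set a := (ν S).toReal
  have ha : a ≤ m := ENNReal.toReal_mono (measure_ne_top _ _) (measure_mono (subset_univ _))
  have ha0 : 0 ≤ a := ENNReal.toReal_nonneg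
  have h2 : I ≤ m * B ^ 2 / N + 2 * B * ω + 8 * B * ω * (N * a / m) := by
    have h3 : N * (m⁻¹ * I) = N / m * I := by ring
    have h4 : B ^ 2 + N * (2 * B * (ω / m) + 8 * B * (N * (ω / m)) * (m⁻¹ * a)) =
      N / m * (m * B ^ 2 / N + 2 * B * ω + 8 * B * ω * (N * a / m)) := by
      field_simp
      ring
    rw [h3, h4] at hW
    exact le_of_mul_le_mul_left hW (by positivity)
  have h5 : m * B ^ 2 / N ≤ B ^ 2 / T := by
    rw [div_le_div_iff₀ hN0 hT]
    nlinarith [sq_nonneg B]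
  have h6 : N * a / m ≤ T * a + 1 := by
    rw [div_le_iff₀ hm0]
    nlinarith
  have h7 : 8 * B * ω * (N * a / m) ≤ 8 * B * ω * (T * a + 1) := by gcongr
  linarith

/-! ### Gradient estimates -/

lemma exists_taylor_bound {φ : Euc n → ℝ} (hφ : ContDiff ℝ (⊤ : ℕ∞) φ) (hc : HasCompactSupport φ) :
    ∃ C : ℝ, 0 ≤ C ∧ ∀ w y, |φ (w - y) - φ w + fderiv ℝ φ w y| ≤ C * ‖y‖ ^ 2 := by
  have hd : ContDiff ℝ 1 (fderiv ℝ φ) := (contDiff_infty_iff_fderiv.1 hφ).2.of_le (by simp)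
  obtain ⟨L, hL⟩ := hd.lipschitzWith_of_hasCompactSupport (hc.fderiv (𝕜 := ℝ)) one_ne_zero
  refine ⟨L, L.2, fun w y => ?_⟩
  have hdiff : Differentiable ℝ φ := hφ.differentiable (by simp)
  have h := (convex_closedBall w ‖y‖).norm_image_sub_le_of_norm_hasFDerivWithin_le'
    (f := φ) (f' := fderiv ℝ φ) (φ := fderiv ℝ φ w) (C := L * ‖y‖) (x := w) (y := w - y)
    (fun z _ => (hdiff z).hasFDerivAt.hasFDerivWithinAt)
    (fun z hz => by
      refine (hL.norm_sub_le z w).trans ?_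
      gcongr
      rwa [mem_closedBall, dist_eq_norm] at hz)
    (by simp) (by simp)
  simp only [sub_sub_cancel_left, map_neg, sub_neg_eq_add, norm_neg, Real.norm_eq_abs] at h
  rw [sq, ← mul_assoc]
  exact h

lemma exists_mollify_expansion {φ : Euc n → ℝ} (hφ : ContDiff ℝ (⊤ : ℕ∞) φ) {r : ℝ} (hr : r ≤ 1)
    (hφ0 : ∀ w, w ∉ ball 0 r → φ w = 0) :
    ∃ C : ℝ, 0 ≤ C ∧ ∀ g : Euc n → ℝ, Continuous g → (∀ x, |g x| ≤ 1) → ∀ x, ∃ a : Euc n,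
      ∀ y : Euc n, ‖y‖ ≤ 1 →
        |(∫ w, φ w * g (x + y + w)) - (∫ w, φ w * g (x + w)) - ⟪a, y⟫| ≤ C * ‖y‖ ^ 2 := by
  have hsupp : tsupport φ ⊆ closedBall 0 r :=
    closure_minimal (fun w hw => by_contra fun h =>
      hw (hφ0 w fun h' => h (ball_subset_closedBall h'))) isClosed_closedBall
  have hc : HasCompactSupport φ := (isCompact_closedBall 0 r).of_isClosed_subset
    (isClosed_tsupport _) hsupp
  obtain ⟨C, hC0, hC⟩ := exists_taylor_bound hφ hc
  have hd : Continuous (fderiv ℝ φ) := hφ.continuous_fderiv (by simp)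
  refine ⟨C * (volume (ball (0 : Euc n) 2)).toReal, by positivity, fun g hg hg1 x => ?_⟩
  have hDc : Continuous fun w => g (x + w) • fderiv ℝ φ w :=
    (hg.comp (continuous_const.add continuous_id)).smul hd
  have hDs : HasCompactSupport fun w => g (x + w) • fderiv ℝ φ w :=
    (hc.fderiv (𝕜 := ℝ)).mono fun w hw h => hw (by
      change g (x + w) • fderiv ℝ φ w = 0
      rw [h, smul_zero])
  have hDi := hDc.integrable_of_hasCompactSupport (μ := volume) hDs
  obtain ⟨A, hA⟩ : ∃ A : Euc n →L[ℝ] ℝ, ∀ y, A y = -∫ w, g (x + w) * fderiv ℝ φ w y :=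
    ⟨-∫ w, g (x + w) • fderiv ℝ φ w, fun y => by
      simp only [neg_apply, ContinuousLinearMap.integral_apply hDi,
        smul_apply, smul_eq_mul]⟩
  refine ⟨(InnerProductSpace.toDual ℝ (Euc n)).symm A, fun y hy => ?_⟩
  rw [InnerProductSpace.toDual_symm_apply]
  have hshift : ∫ w, φ w * g (x + y + w) = ∫ w, φ (w - y) * g (x + w) := by
    rw [← integral_sub_right_eq_self _ y]
    refine integral_congr_ae (Filter.Eventually.of_forall fun w => ?_)
    simp only
    congr 2
    abel
  have hi1 : Integrable fun w => φ w * g (x + w) :=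
    Continuous.integrable_of_hasCompactSupport (by have := hφ.continuous; fun_prop) hc.mul_right
  have hi2 : Integrable fun w => φ (w - y) * g (x + w) := by
    refine Continuous.integrable_of_hasCompactSupport (by have := hφ.continuous; fun_prop)
      (HasCompactSupport.mul_right ?_)
    exact hc.comp_homeomorph (Homeomorph.subRight y)
  have hi3 : Integrable fun w => g (x + w) * fderiv ℝ φ w y := by
    simpa using hDi.apply_continuousLinearMap y
  have he : (∫ w, φ w * g (x + y + w)) - (∫ w, φ w * g (x + w)) - A y =
      ∫ w, (φ (w - y) - φ w + fderiv ℝ φ w y) * g (x + w) := by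
    have hi12 : Integrable fun w => φ (w - y) * g (x + w) - φ w * g (x + w) := hi2.sub hi1
    rw [hA y, hshift, ← integral_sub hi2 hi1, sub_neg_eq_add, ← integral_add hi12 hi3]
    congr 1
    ext w
    ring
  have hzero : ∀ w, w ∉ ball (0 : Euc n) 2 →
      (φ (w - y) - φ w + fderiv ℝ φ w y) * g (x + w) = 0 := by
    intro w hw
    rw [mem_ball_zero_iff, not_lt] at hw
    have h1 : φ w = 0 := hφ0 w (by rw [mem_ball_zero_iff]; linarith)
    have h2 : φ (w - y) = 0 := hφ0 _ (by
      rw [mem_ball_zero_iff]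
      have := norm_sub_norm_le w y
      linarith)
    have h3 : fderiv ℝ φ w = 0 := by
      by_contra h
      have h4 := hsupp (support_fderiv_subset ℝ h)
      rw [mem_closedBall_zero_iff] at h4
      linarith
    rw [h1, h2, h3]
    simp
  rw [he, ← setIntegral_eq_integral_of_forall_compl_eq_zero hzero]
  have hb := norm_setIntegral_le_of_norm_le_const (μ := volume) (s := ball (0 : Euc n) 2)
    (f := fun w => (φ (w - y) - φ w + fderiv ℝ φ w y) * g (x + w)) (C := C * ‖y‖ ^ 2)
    measure_ball_lt_top (fun w _ => by
      rw [norm_mul]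
      exact (mul_le_mul (hC w y) (hg1 _) (abs_nonneg _) (by positivity)).trans (mul_one _).le)
  rw [Real.norm_eq_abs, measureReal_def] at hb
  linarith

/-- A function whose increments are small in the mean square sense with respect to a
nondegenerate measure has small gradient. -/
lemma elliptic_gradient_bound {s lam Lam C₂ C₃ C₄ : ℝ} (hC₂ : 0 ≤ C₂) (hC₄ : 0 ≤ C₄)
    {ν : Measure (Euc n)}
    (hν : AnnulusBound s Lam ν)
    (hell : ∀ r : ℝ, 0 < r → ∀ e : Euc n, ‖e‖ = 1 → ENNReal.ofReal lam ≤
      ENNReal.ofReal (r ^ (2 * s - 2)) * ∫⁻ y in ball 0 r, ENNReal.ofReal (⟪e, y⟫ ^ 2) ∂ν)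
    (hnear₂ : ∀ ν : Measure (Euc n), AnnulusBound s Lam ν → ∀ τ : ℝ, 0 < τ →
      ∫⁻ y in ball 0 τ, ENNReal.ofReal (‖y‖ ^ (2 : ℝ)) ∂ν ≤
        ENNReal.ofReal (C₂ * τ ^ (2 - 2 * s)))
    (hnear₄ : ∀ ν : Measure (Euc n), AnnulusBound s Lam ν → ∀ τ : ℝ, 0 < τ →
      ∫⁻ y in ball 0 τ, ENNReal.ofReal (‖y‖ ^ (4 : ℝ)) ∂ν ≤
        ENNReal.ofReal (C₄ * τ ^ (4 - 2 * s)))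
    {ρ τ ε : ℝ} (hρ : 0 < ρ) (hρ1 : ρ ≤ 1) (hτ : 0 < τ) {v : Euc n → ℝ} {a : Euc n}
    (hva : ∀ y : Euc n, ‖y‖ ≤ 1 → |v y - v 0 - ⟪a, y⟫| ≤ C₃ * ‖y‖ ^ 2)
    (hi : IntegrableOn (fun y => (v y - v 0) ^ 2) (ball 0 ρ \ ball 0 τ) ν)
    (hε : ∫ y in ball 0 ρ \ ball 0 τ, (v y - v 0) ^ 2 ∂ν ≤ ε) :
    lam * ‖a‖ ^ 2 ≤ ρ ^ (2 * s - 2) *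
      (‖a‖ ^ 2 * (C₂ * τ ^ (2 - 2 * s)) + (2 * ε + 2 * C₃ ^ 2 * (C₄ * ρ ^ (4 - 2 * s)))) := by
  have hε0 : 0 ≤ ε := (integral_nonneg fun y => sq_nonneg _).trans hε
  rcases eq_or_ne a 0 with rfl | ha
  · simp only [norm_zero, ne_eq, OfNat.ofNat_ne_zero, not_false_eq_true, zero_pow, mul_zero]
    positivity
  have ha0 : 0 < ‖a‖ := norm_pos_iff.2 ha
  set S := ball (0 : Euc n) ρ \ ball 0 τ with hS
  have hSm : MeasurableSet S := measurableSet_ball.diff measurableSet_ball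
  have hball : ∫⁻ y in ball 0 ρ, ENNReal.ofReal (⟪a, y⟫ ^ 2) ∂ν ≤
      ENNReal.ofReal (‖a‖ ^ 2 * (C₂ * τ ^ (2 - 2 * s)) +
        (2 * ε + 2 * C₃ ^ 2 * (C₄ * ρ ^ (4 - 2 * s)))) := by
    have hsub : ball (0 : Euc n) ρ ⊆ ball 0 τ ∪ S := fun y hy => by
      by_cases h : y ∈ ball (0 : Euc n) τ
      · exact Or.inl h
      · exact Or.inr ⟨hy, h⟩
    refine (lintegral_mono_set hsub).trans ((lintegral_union_le _ _ _).trans ?_)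
    rw [ENNReal.ofReal_add (by positivity) (by positivity)]
    refine add_le_add ?_ ?_
    · calc ∫⁻ y in ball 0 τ, ENNReal.ofReal (⟪a, y⟫ ^ 2) ∂ν
          ≤ ∫⁻ y in ball 0 τ, ENNReal.ofReal (‖a‖ ^ 2) * ENNReal.ofReal (‖y‖ ^ (2 : ℝ)) ∂ν := by
            refine lintegral_mono fun y => ?_
            rw [← ENNReal.ofReal_mul (by positivity), Real.rpow_two, ← mul_pow]
            refine ENNReal.ofReal_le_ofReal ?_
            rw [← sq_abs]
            exact pow_le_pow_left₀ (abs_nonneg _) (abs_real_inner_le_norm a y) 2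
        _ = ENNReal.ofReal (‖a‖ ^ 2) * ∫⁻ y in ball 0 τ, ENNReal.ofReal (‖y‖ ^ (2 : ℝ)) ∂ν :=
            lintegral_const_mul' _ _ ENNReal.ofReal_ne_top
        _ ≤ _ := by
            rw [ENNReal.ofReal_mul (by positivity)]
            gcongr
            exact hnear₂ ν hν τ hτ
    · calc ∫⁻ y in S, ENNReal.ofReal (⟪a, y⟫ ^ 2) ∂ν
          ≤ ∫⁻ y in S, (ENNReal.ofReal 2 * ENNReal.ofReal ((v y - v 0) ^ 2) +
              ENNReal.ofReal (2 * C₃ ^ 2) * ENNReal.ofReal (‖y‖ ^ (4 : ℝ))) ∂ν := by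
            refine setLIntegral_mono' hSm fun y hy => ?_
            rw [← ENNReal.ofReal_mul (by positivity), ← ENNReal.ofReal_mul (by positivity),
              ← ENNReal.ofReal_add (by positivity) (by positivity)]
            refine ENNReal.ofReal_le_ofReal ?_
            have hy1 : ‖y‖ < ρ := by simpa using hy.1
            have h1 := hva y (by linarith)
            have h2 : (v y - v 0 - ⟪a, y⟫) ^ 2 ≤ (C₃ * ‖y‖ ^ 2) ^ 2 := by
              rw [← sq_abs]
              exact pow_le_pow_left₀ (abs_nonneg _) h1 2
            have h3 : ‖y‖ ^ (4 : ℝ) = (‖y‖ ^ 2) ^ 2 := by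
              rw [← pow_mul]; exact_mod_cast Real.rpow_natCast ‖y‖ 4
            rw [h3]
            nlinarith [sq_nonneg (2 * (v y - v 0) - ⟪a, y⟫)]
        _ = ENNReal.ofReal 2 * ∫⁻ y in S, ENNReal.ofReal ((v y - v 0) ^ 2) ∂ν +
            ENNReal.ofReal (2 * C₃ ^ 2) * ∫⁻ y in S, ENNReal.ofReal (‖y‖ ^ (4 : ℝ)) ∂ν := by
            rw [lintegral_add_right _ (by fun_prop),
              lintegral_const_mul' _ _ ENNReal.ofReal_ne_top,
              lintegral_const_mul' _ _ ENNReal.ofReal_ne_top]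
        _ ≤ ENNReal.ofReal 2 * ENNReal.ofReal ε +
            ENNReal.ofReal (2 * C₃ ^ 2) * ENNReal.ofReal (C₄ * ρ ^ (4 - 2 * s)) := by
            gcongr
            · rw [← ofReal_integral_eq_lintegral_ofReal hi
                (Filter.Eventually.of_forall fun y => sq_nonneg _)]
              exact ENNReal.ofReal_le_ofReal hε
            · exact (lintegral_mono_set sdiff_subset).trans (hnear₄ ν hν ρ hρ)
        _ = _ := by
            rw [← ENNReal.ofReal_mul (by positivity), ← ENNReal.ofReal_mul (by positivity),
              ← ENNReal.ofReal_add (by positivity) (by positivity)]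
  have h1 := hell ρ hρ (‖a‖⁻¹ • a) (by rw [norm_smul, norm_inv, norm_norm, inv_mul_cancel₀ ha0.ne'])
  have h2 : ∫⁻ y in ball 0 ρ, ENNReal.ofReal (⟪‖a‖⁻¹ • a, y⟫ ^ 2) ∂ν =
      ENNReal.ofReal ((‖a‖⁻¹) ^ 2) * ∫⁻ y in ball 0 ρ, ENNReal.ofReal (⟪a, y⟫ ^ 2) ∂ν := by
    rw [← lintegral_const_mul' _ _ ENNReal.ofReal_ne_top]
    refine lintegral_congr fun y => ?_
    rw [← ENNReal.ofReal_mul (by positivity), real_inner_smul_left, mul_pow]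
  rw [h2] at h1
  have h3 := h1.trans (mul_le_mul_right (mul_le_mul_right hball _) _)
  rw [← ENNReal.ofReal_mul (by positivity), ← ENNReal.ofReal_mul (by positivity),
    ENNReal.ofReal_le_ofReal_iff (by positivity)] at h3
  refine (mul_le_mul_of_nonneg_right h3 (sq_nonneg ‖a‖)).trans (le_of_eq ?_)
  field_simp

/-! ### Mollification of Hölder functions -/

/-- A smooth probability density supported in a ball. -/
structure IsMollifier (φ : Euc n → ℝ) (r : ℝ) : Prop where
  contDiff : ContDiff ℝ (⊤ : ℕ∞) φ
  eq_zero : ∀ w, w ∉ ball 0 r → φ w = 0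
  nonneg : ∀ w, 0 ≤ φ w
  integral_eq_one : ∫ w, φ w = 1

/-- The average of `u` around `x` with weight `φ`. -/
def mollify (φ u : Euc n → ℝ) (x : Euc n) : ℝ := ∫ w, φ w * u (x + w)

lemma exists_isMollifier (n : ℕ) {r : ℝ} (hr : 0 < r) : ∃ φ : Euc n → ℝ, IsMollifier φ r := by
  let b : ContDiffBump (0 : Euc n) := ⟨r / 2, r, by positivity, by linarith⟩
  refine ⟨b.normed volume, b.contDiff_normed, fun w hw => ?_, b.nonneg_normed,
    b.integral_normed⟩
  by_contra h
  have h1 : w ∈ Function.support (b.normed volume) := h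
  rw [b.support_normed_eq] at h1
  exact hw h1

namespace IsMollifier

variable {φ u : Euc n → ℝ} {r β : ℝ}

lemma hasCompactSupport (hφ : IsMollifier φ r) : HasCompactSupport φ :=
  HasCompactSupport.intro (isCompact_closedBall 0 r) fun w hw =>
    hφ.eq_zero w fun h => hw (ball_subset_closedBall h)

lemma exists_bounds (hφ : IsMollifier φ r) : ∃ L M : ℝ, 0 ≤ L ∧ 0 ≤ M ∧ (∀ w, |φ w| ≤ M) ∧
    ∀ x y, |φ x - φ y| ≤ L * ‖x - y‖ := by
  obtain ⟨L, hL⟩ := (hφ.contDiff.of_le (m := 1) (by simp)).lipschitzWith_of_hasCompactSupport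
    hφ.hasCompactSupport one_ne_zero
  obtain ⟨M, hM⟩ := hφ.contDiff.continuous.bounded_above_of_compact_support hφ.hasCompactSupport
  exact ⟨L, M, L.2, (norm_nonneg _).trans (hM 0), hM, fun x y => hL.norm_sub_le x y⟩

lemma integrable_mul (hφ : IsMollifier φ r) (hu : Continuous u) (x : Euc n) :
    Integrable fun w => φ w * u (x + w) :=
  Continuous.integrable_of_hasCompactSupport
    (hφ.contDiff.continuous.mul (hu.comp (continuous_const.add continuous_id)))
    hφ.hasCompactSupport.mul_right

lemma integrable (hφ : IsMollifier φ r) : Integrable φ :=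
  hφ.contDiff.continuous.integrable_of_hasCompactSupport hφ.hasCompactSupport

lemma abs_integral_mul_le (hφ : IsMollifier φ r) {g : Euc n → ℝ} {G : ℝ}
    (hg : ∀ w ∈ ball (0 : Euc n) r, |g w| ≤ G) : |∫ w, φ w * g w| ≤ G := by
  have h : ‖∫ w, φ w * g w‖ ≤ ∫ w, φ w * G := by
    refine norm_integral_le_of_norm_le (hφ.integrable.mul_const G)
      (Filter.Eventually.of_forall fun w => ?_)
    rw [Real.norm_eq_abs, abs_mul, abs_of_nonneg (hφ.nonneg w)]
    by_cases hw : w ∈ ball (0 : Euc n) r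
    · exact mul_le_mul_of_nonneg_left (hg w hw) (hφ.nonneg w)
    · simp [hφ.eq_zero w hw]
  rwa [integral_mul_const, hφ.integral_eq_one, one_mul] at h

lemma abs_mollify_sub_le (hφ : IsMollifier φ r) (hu : Continuous u)
    (hH : ∀ x y, |u x - u y| ≤ ‖x - y‖ ^ β) (x y : Euc n) :
    |mollify φ u x - mollify φ u y| ≤ ‖x - y‖ ^ β := by
  unfold mollify
  rw [← integral_sub (hφ.integrable_mul hu x) (hφ.integrable_mul hu y)]
  simp only [← mul_sub]
  refine hφ.abs_integral_mul_le fun w _ => ?_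
  simpa using hH (x + w) (y + w)

lemma abs_mollify_sub_self_le (hφ : IsMollifier φ r) (hβ : 0 ≤ β) (hu : Continuous u)
    (hH : ∀ x y, |u x - u y| ≤ ‖x - y‖ ^ β) (x : Euc n) : |mollify φ u x - u x| ≤ r ^ β := by
  have h : mollify φ u x - u x = ∫ w, φ w * (u (x + w) - u x) := by
    simp only [mul_sub]
    rw [integral_sub (hφ.integrable_mul hu x) (hφ.integrable.mul_const _), integral_mul_const,
      hφ.integral_eq_one, one_mul, mollify]
  rw [h]
  refine hφ.abs_integral_mul_le fun w hw => (hH _ _).trans ?_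
  rw [add_sub_cancel_left]
  exact Real.rpow_le_rpow (norm_nonneg _) (mem_ball_zero_iff.1 hw).le hβ

lemma continuous_mollify (hφ : IsMollifier φ r) (hβ : 0 < β) (hu : Continuous u)
    (hH : ∀ x y, |u x - u y| ≤ ‖x - y‖ ^ β) : Continuous (mollify φ u) := by
  rw [continuous_iff_continuousAt]
  intro x
  rw [ContinuousAt, tendsto_iff_norm_sub_tendsto_zero]
  refine squeeze_zero (fun y => norm_nonneg _) (fun y => hφ.abs_mollify_sub_le hu hH y x) ?_
  have h : ContinuousAt (fun y : Euc n => ‖y - x‖ ^ β) x :=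
    ContinuousAt.rpow_const (by fun_prop) (Or.inr hβ.le)
  simpa [ContinuousAt, Real.zero_rpow hβ.ne'] using h

end IsMollifier

/-! ### Choice of parameters -/

lemma exists_mul_rpow_le {A p ω τ₀ : ℝ} (hp : 0 < p) (hω : 0 < ω) (hτ₀ : 0 < τ₀) :
    ∃ τ : ℝ, 0 < τ ∧ τ ≤ τ₀ ∧ A * τ ^ p ≤ ω := by
  have hA : Filter.Tendsto (fun τ : ℝ => A * τ ^ p) (𝓝[>] 0) (𝓝 0) := by
    have h : ContinuousAt (fun τ : ℝ => A * τ ^ p) 0 :=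
      continuousAt_const.mul (Real.continuousAt_rpow_const _ _ (Or.inr hp.le))
    have h' := h.tendsto
    rw [Real.zero_rpow hp.ne', mul_zero] at h'
    exact h'.mono_left nhdsWithin_le_nhds
  obtain ⟨τ, h1, h2⟩ := ((hA.eventually (gt_mem_nhds hω)).and (Ioc_mem_nhdsGT hτ₀)).exists
  exact ⟨τ, h2.1, h2.2, h1.le⟩

lemma exists_truncation_radii {s β A B ω τ₀ ρ : ℝ} (h1 : 2 * s < 1 + β) (h2 : β < 2 * s)
    (hω : 0 < ω) (hτ₀ : 0 < τ₀) : ∃ (τ : ℝ) (J : ℕ), 0 < τ ∧ τ ≤ τ₀ ∧ ρ ≤ 2 ^ J * τ ∧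
      A * τ ^ (1 + β - 2 * s) + B * (2 ^ J * τ) ^ (β - 2 * s) ≤ ω := by
  obtain ⟨τ, hτ1, hτ2, hτ3⟩ := exists_mul_rpow_le (A := A) (p := 1 + β - 2 * s) (by linarith)
    (half_pos hω) hτ₀
  have hg : Filter.Tendsto (fun J : ℕ => (2 : ℝ) ^ J * τ) Filter.atTop Filter.atTop :=
    (tendsto_pow_atTop_atTop_of_one_lt one_lt_two).atTop_mul_const hτ1
  have hB : Filter.Tendsto (fun J : ℕ => B * ((2 : ℝ) ^ J * τ) ^ (β - 2 * s)) Filter.atTop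
      (𝓝 0) := by
    have h := (tendsto_rpow_neg_atTop (y := 2 * s - β) (by linarith)).comp hg
    simpa [Function.comp_def] using h.const_mul B
  obtain ⟨J, hJ1, hJ2⟩ := ((hB.eventually (gt_mem_nhds (half_pos hω))).and
    (hg.eventually_ge_atTop ρ)).exists
  exact ⟨τ, J, hτ1, hτ2, hJ2, by linarith⟩

lemma exists_small_scale (a R : ℝ) {ω : ℝ} (hω : 0 < ω) :
    ∃ δ₀ > (0 : ℝ), ∀ δ : ℝ, 0 < δ → δ < δ₀ → R < 1 / δ ∧ a * δ ≤ ω := by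
  refine ⟨min (1 / (|R| + 1)) (ω / (|a| + 1)), by positivity, fun δ hδ h => ?_⟩
  obtain ⟨h1, h2⟩ := lt_min_iff.1 h
  rw [lt_div_iff₀ (by positivity)] at h1 h2
  constructor
  · rw [lt_div_iff₀ hδ]
    nlinarith [le_abs_self R]
  · nlinarith [le_abs_self a]

/-- The rescaled setting of the Liouville theorem, translated into the estimates used below. -/
structure IsAlmostSolution (s β q lam Lam δ : ℝ) (K : Euc n → Measure (Euc n))
    (u f : Euc n → ℝ) : Prop where
  measKernel : MeasKernel K
  symm : DivSymmetric K
  elliptic : DivElliptic s lam Lam K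
  tvDiff_le : ∀ x, ∀ ρ : ℝ, 0 < ρ →
    tvDiff ((K x).map fun z => z - x) (K 0) (ball 0 (2 * ρ) \ ball 0 ρ) ≤
      ENNReal.ofReal (δ * ρ ^ (-(2 * s)))
  continuous : Continuous u
  holder : ∀ x y, |u x - u y| ≤ ‖x - y‖ ^ β
  eLpNorm_le : eLpNorm f (ENNReal.ofReal q) (volume.restrict (ball 0 (1 / δ))) ≤ ENNReal.ofReal δ
  weakSol : WeakSol K u f (ball 0 (1 / δ))

lemma IsAlmostSolution.annulusBound_zero {s β q lam Lam δ : ℝ} {K : Euc n → Measure (Euc n)}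
    {u f : Euc n → ℝ} (h : IsAlmostSolution s β q lam Lam δ K u f) :
    AnnulusBound s Lam (K 0) := by
  simpa using h.elliptic.annulusBound 0

/-- The truncated operator at the origin almost annihilates the mollified solution. -/
lemma exists_shell_integral_mollify_le {s β q lam Lam : ℝ} (hs : 0 < s) (hLam : 0 ≤ Lam)
    (hβ0 : 0 < β) (hβ1 : 2 * s < 1 + β) (hβ2 : β < 2 * s) (hq : 1 ≤ q) {φ : Euc n → ℝ} {r : ℝ}
    (hφ : IsMollifier φ r) (hr : r ≤ 1) {ω τ₀ ρ : ℝ} (hω : 0 < ω) (hτ₀ : 0 < τ₀) :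
    ∃ (τ : ℝ) (J : ℕ), 0 < τ ∧ τ ≤ τ₀ ∧ ρ ≤ 2 ^ J * τ ∧ ∀ P : ℝ, ∃ δ₀ > (0 : ℝ), ∀ δ : ℝ, 0 < δ →
      δ < δ₀ → ∀ (K : Euc n → Measure (Euc n)) (u f : Euc n → ℝ),
      IsAlmostSolution s β q lam Lam δ K u f → ∀ x, ‖x‖ ≤ P →
      |∫ y in ball 0 (2 ^ J * τ) \ ball 0 τ, (mollify φ u x - mollify φ u (x + y)) ∂(K 0)| ≤ ω := by
  obtain ⟨C₁, hC₁, hnear⟩ := exists_near_moment (n := n) s Lam (1 + β) hs hLam hβ1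
  obtain ⟨C₂, hC₂, hfar⟩ := exists_far_moment (n := n) s Lam β hLam hβ0.le hβ2
  obtain ⟨L, M, hL, hM, hφM, hφL⟩ := hφ.exists_bounds
  set V := (volume (ball (0 : Euc n) 2)).toReal
  obtain ⟨τ, J, hτ, hτ', hρ, hAB⟩ := exists_truncation_radii (A := L * C₁ * V) (B := C₂) (ρ := ρ)
    hβ1 hβ2 (half_pos hω) (lt_min hτ₀ one_pos)
  obtain ⟨hτ1, hτ2⟩ := le_min_iff.1 hτ'
  refine ⟨τ, J, hτ, hτ1, hρ, fun P => ?_⟩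
  obtain ⟨δ₀, hδ₀, h⟩ := exists_small_scale
    (J * ((2 ^ J * τ) ^ β * τ ^ (-(2 * s))) + M * (1 + V)) (P + 1) (half_pos hω)
  refine ⟨δ₀, hδ₀, fun δ hδ hδ' K u f D x hx => ?_⟩
  obtain ⟨h1, h2⟩ := h δ hδ hδ'
  refine (abs_shell_integral_mollify_le hs hLam hβ0 hC₁ hC₂ hq hδ hnear hfar D.measKernel D.symm
    D.elliptic.annulusBound D.tvDiff_le D.continuous D.holder D.eLpNorm_le D.weakSol hφ.contDiff hr
    hφ.eq_zero hφ.nonneg hφ.integral_eq_one hL hφM hφL hτ hτ2 J (by linarith)).trans ?_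
  linarith

lemma exists_sq_increment_mollify_le {s β q lam Lam : ℝ} (hs : 0 < s) (hLam : 0 ≤ Lam)
    (hβ0 : 0 < β) (hβ1 : 2 * s < 1 + β) (hβ2 : β < 2 * s) (hq : 1 ≤ q) {φ : Euc n → ℝ} {r : ℝ}
    (hφ : IsMollifier φ r) (hr : r ≤ 1) {ε τ ρ : ℝ} (hε : 0 < ε) (hτ : 0 < τ) (hρ : 0 ≤ ρ)
    (P : ℝ) :
    ∃ δ₀ > (0 : ℝ), ∀ δ : ℝ, 0 < δ →
      δ < δ₀ → ∀ (K : Euc n → Measure (Euc n)) (u f : Euc n → ℝ),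
      IsAlmostSolution s β q lam Lam δ K u f → ∀ h x, ‖h‖ ≤ 1 → ‖x‖ ≤ P →
      ∫ y in ball 0 ρ \ ball 0 τ, ((mollify φ u (x + y + h) - mollify φ u (x + y)) -
        (mollify φ u (x + h) - mollify φ u x)) ^ 2 ∂(K 0) ≤ ε := by
  obtain ⟨C, hC, hfar⟩ := exists_far_moment (n := n) s Lam 0 hLam le_rfl (by linarith)
  have hmass : ∀ ν : Measure (Euc n), AnnulusBound s Lam ν → ∀ t : ℝ, 0 < t → ∀ A ⊆ (ball 0 t)ᶜ,
      (ν A).toReal ≤ C * t ^ (0 - 2 * s) := fun ν hν t ht A hA => by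
    refine ENNReal.toReal_le_of_le_ofReal (by positivity) ((measure_mono hA).trans ?_)
    simpa using hfar ν hν t ht
  set m := C * τ ^ (0 - 2 * s) with hm
  have hm0 : 0 ≤ m := by positivity
  set T := 2 / ε with hT
  have hT0 : 0 < T := by positivity
  set k := 2 + 8 * (T * m + 1) with hk
  have hk0 : 0 < k := by positivity
  set ω := ε / (2 * k) with hω
  have hω0 : 0 < ω := by positivity
  obtain ⟨t, J, ht, htτ, hρJ, H⟩ := exists_shell_integral_mollify_le (lam := lam) hs hLam hβ0 hβ1
    hβ2 hq hφ hr (ρ := ρ) (half_pos hω0) hτ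
  set R₀ := 2 ^ J * t with hR₀
  have hR₀0 : 0 < R₀ := by positivity
  set R := (T * (C * t ^ (0 - 2 * s)) + 1) * R₀ + ρ with hR
  obtain ⟨δ₀, hδ₀, H⟩ := H (P + R + 1)
  refine ⟨δ₀, hδ₀, fun δ hδ hδ' K u f D h x hh hx => ?_⟩
  have HU := H δ hδ hδ' K u f D
  have hann := D.annulusBound_zero
  have hUc := hφ.continuous_mollify hβ0 D.continuous D.holder
  set U := mollify φ u
  set S₀ : Set (Euc n) := ball 0 R₀ \ ball 0 t with hS₀
  set S : Set (Euc n) := ball 0 ρ \ ball 0 τ with hS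
  have hSS : S ⊆ S₀ := sdiff_subset_sdiff (ball_subset_ball hρJ) (ball_subset_ball htτ)
  have hSm : MeasurableSet S := measurableSet_ball.diff measurableSet_ball
  have hS₀m : MeasurableSet S₀ := measurableSet_ball.diff measurableSet_ball
  have hfin : IsFiniteMeasure ((K 0).restrict S₀) := ⟨by simpa using (hann.ne_top ht J).lt_top⟩
  have hν : (((K 0).restrict S₀) univ).toReal ≤ C * t ^ (0 - 2 * s) := by
    rw [Measure.restrict_apply_univ]
    exact hmass _ hann t ht _ fun y hy => hy.2
  have hνS : (((K 0).restrict S₀) S).toReal ≤ m := by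
    rw [Measure.restrict_apply hSm, inter_eq_left.2 hSS]
    exact hmass _ hann τ hτ _ fun y hy => hy.2
  have hint : ∀ z, Integrable (fun y => U z - U (z + y)) ((K 0).restrict S₀) := fun z => by
    refine Integrable.of_bound (C := R₀ ^ β) (by fun_prop) ?_
    filter_upwards [ae_restrict_mem hS₀m] with y hy
    refine (hφ.abs_mollify_sub_le D.continuous D.holder _ _).trans ?_
    rw [sub_add_cancel_left, norm_neg]
    exact Real.rpow_le_rpow (norm_nonneg _) (mem_ball_zero_iff.1 hy.1).le hβ0.le
  have key := setIntegral_sq_increment_le (ν := (K 0).restrict S₀) (R₀ := R₀) (R₁ := ρ) (B := 1)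
    (ω := ω) (T := T) (R := R) (v := fun y => U (x + y + h) - U (x + y)) hR₀0.le hρ hω0.le hT0
    (by
      filter_upwards [ae_restrict_mem hS₀m] with y hy
      exact (mem_ball_zero_iff.1 hy.1).le)
    (by fun_prop)
    (fun y => (hφ.abs_mollify_sub_le D.continuous D.holder _ _).trans (by
      rw [add_sub_cancel_left]
      exact Real.rpow_le_one (norm_nonneg _) hh hβ0.le))
    (by rw [hR]; gcongr)
    (fun y hy => by
      have h1 := HU (x + y + h) ((norm_add₃_le).trans (by linarith))
      have h2 := HU (x + y) ((norm_add_le _ _).trans (by linarith))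
      have h3 : ∫ z in S₀, ((U (x + y + h) - U (x + y)) - (U (x + (y + z) + h) - U (x + (y + z))))
          ∂(K 0) = (∫ z in S₀, (U (x + y + h) - U (x + y + h + z)) ∂(K 0)) -
            ∫ z in S₀, (U (x + y) - U (x + y + z)) ∂(K 0) := by
        rw [← integral_sub (hint _) (hint _)]
        refine integral_congr_ae (Filter.Eventually.of_forall fun z => ?_)
        simp only [← add_assoc, add_right_comm (x + y) z h]
        ring
      rw [h3]
      exact (abs_sub _ _).trans (by linarith)) hSm (fun y hy => (mem_ball_zero_iff.1 hy.1).le)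
  rw [Measure.restrict_restrict hSm, inter_eq_left.2 hSS] at key
  simp only [add_zero] at key
  refine key.trans ?_
  have h4 : T * (((K 0).restrict S₀) S).toReal ≤ T * m := by gcongr
  have h5 : (1 : ℝ) ^ 2 / T = ε / 2 := by rw [hT]; field_simp
  have h6 : ω * k = ε / 2 := by rw [hω]; field_simp
  rw [h5]
  nlinarith

lemma hasFDerivAt_of_quadratic_bound {v : Euc n → ℝ} {x a : Euc n} {C : ℝ}
    (h : ∀ y : Euc n, ‖y‖ ≤ 1 → |v (x + y) - v x - ⟪a, y⟫| ≤ C * ‖y‖ ^ 2) :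
    HasFDerivAt v (innerSL ℝ a) x := by
  rw [hasFDerivAt_iff_isLittleO_nhds_zero]
  refine Asymptotics.IsBigO.trans_isLittleO (g := fun y : Euc n => ‖y‖ ^ 2)
    (Asymptotics.IsBigO.of_bound C ?_) (Asymptotics.isLittleO_norm_pow_id one_lt_two)
  filter_upwards [closedBall_mem_nhds (0 : Euc n) one_pos] with y hy
  simpa using h y (mem_closedBall_zero_iff.1 hy)

/-- The increments of the mollified solution are almost constant. -/
lemma exists_second_increment_mollify_le {s β q lam Lam : ℝ} (hs : 0 < s) (hs1 : s < 1)
    (hlam : 0 < lam) (hLam : 0 ≤ Lam)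
    (hβ0 : 0 < β) (hβ1 : 2 * s < 1 + β) (hβ2 : β < 2 * s) (hq : 1 ≤ q) {φ : Euc n → ℝ} {r : ℝ}
    (hφ : IsMollifier φ r) (hr : r ≤ 1) {κ : ℝ} (hκ : 0 < κ) (P : ℝ) :
    ∃ δ₀ > (0 : ℝ), ∀ δ : ℝ, 0 < δ →
      δ < δ₀ → ∀ (K : Euc n → Measure (Euc n)) (u f : Euc n → ℝ),
      IsAlmostSolution s β q lam Lam δ K u f → ∀ h x, ‖h‖ ≤ 1 → ‖x‖ ≤ P →
      |(mollify φ u (x + h) - mollify φ u x) - (mollify φ u h - mollify φ u 0)| ≤ κ * ‖x‖ := by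
  obtain ⟨C₂, hC₂, hnear₂⟩ := exists_near_moment (n := n) s Lam 2 hs hLam (by linarith)
  obtain ⟨C₄, hC₄, hnear₄⟩ := exists_near_moment (n := n) s Lam 4 hs hLam (by linarith)
  obtain ⟨C₃, hC₃, hexp⟩ := exists_mollify_expansion hφ.contDiff hr hφ.eq_zero
  obtain ⟨ρ, hρ, hρ1, hρC⟩ := exists_mul_rpow_le (A := 2 * C₃ ^ 2 * C₄) (p := 2)
    (ω := lam * κ ^ 2 / 4) two_pos (by positivity) one_pos
  obtain ⟨τ, hτ, -, hτC⟩ := exists_mul_rpow_le (A := ρ ^ (2 * s - 2) * C₂) (p := 2 - 2 * s)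
    (ω := lam / 2) (by linarith) (by positivity) one_pos
  obtain ⟨δ₀, hδ₀, H⟩ := exists_sq_increment_mollify_le (lam := lam) hs hLam hβ0 hβ1 hβ2 hq hφ hr
    (ε := lam * κ ^ 2 / (8 * ρ ^ (2 * s - 2))) (by positivity) hτ hρ.le P
  refine ⟨δ₀, hδ₀, fun δ hδ hδ' K u f D h x hh hx => ?_⟩
  have hann := D.annulusBound_zero
  have hu := D.continuous
  have hUc := hφ.continuous_mollify hβ0 hu D.holder
  have hell : ∀ t : ℝ, 0 < t → ∀ e : Euc n, ‖e‖ = 1 → ENNReal.ofReal lam ≤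
      ENNReal.ofReal (t ^ (2 * s - 2)) * ∫⁻ y in ball 0 t, ENNReal.ofReal (⟪e, y⟫ ^ 2) ∂(K 0) := by
    simpa using D.elliptic.2 0
  have hfin : IsFiniteMeasure ((K 0).restrict (ball 0 ρ \ ball 0 τ)) := by
    obtain ⟨J, hJ⟩ := pow_unbounded_of_one_lt (ρ / τ) one_lt_two
    rw [div_lt_iff₀ hτ] at hJ
    refine ⟨?_⟩
    rw [Measure.restrict_apply_univ]
    exact (measure_mono (sdiff_subset_sdiff_left (ball_subset_ball hJ.le))).trans_lt
      (hann.ne_top hτ J).lt_top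
  set v : Euc n → ℝ := fun x => mollify φ u (x + h) - mollify φ u x with hv
  have hvc : Continuous v := by fun_prop
  have hvB : ∀ y, |v y| ≤ 1 := fun y => (hφ.abs_mollify_sub_le hu D.holder _ _).trans (by
    rw [add_sub_cancel_left]
    exact Real.rpow_le_one (norm_nonneg _) hh hβ0.le)
  have hvg : ∀ y, ∫ w, φ w * (u (y + w + h) - u (y + w)) = v y := fun y => by
    simp only [mul_sub, hv, mollify, add_right_comm y _ h]
    exact integral_sub (hφ.integrable_mul hu _) (hφ.integrable_mul hu y)
  have hgrad : ∀ z : Euc n, ∃ a : Euc n, HasFDerivAt v (innerSL ℝ a) z ∧ (‖z‖ ≤ P → ‖a‖ ≤ κ) := by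
    intro z
    obtain ⟨a, ha⟩ := hexp (fun w => u (w + h) - u w) (by fun_prop)
      (fun w => (D.holder _ _).trans (by
        rw [add_sub_cancel_left]
        exact Real.rpow_le_one (norm_nonneg _) hh hβ0.le)) z
    simp only [hvg] at ha
    refine ⟨a, hasFDerivAt_of_quadratic_bound ha, fun hz => ?_⟩
    have hb := elliptic_gradient_bound hC₂ hC₄ hann hell hnear₂ hnear₄ hρ hρ1 hτ (C₃ := C₃)
      (v := fun y => v (z + y)) (a := a) (by simpa using ha)
      (Integrable.of_bound (C := 4) (by fun_prop) (Filter.Eventually.of_forall fun y => by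
        rw [Real.norm_eq_abs, abs_of_nonneg (sq_nonneg _)]
        have h1 := abs_le.1 (hvB (z + y))
        have h2 := abs_le.1 (hvB (z + 0))
        nlinarith))
      (by simpa using H δ hδ hδ' K u f D h z hh hz)
    have h1 : ρ ^ (2 * s - 2) * ρ ^ (4 - 2 * s) = ρ ^ (2 : ℝ) := by
      rw [← Real.rpow_add hρ]; ring_nf
    have h2 : ρ ^ (2 * s - 2) * (2 * (lam * κ ^ 2 / (8 * ρ ^ (2 * s - 2)))) =
        lam * κ ^ 2 / 4 := by
      field_simp
      norm_num
    have h3 : lam * ‖a‖ ^ 2 ≤ ‖a‖ ^ 2 * (lam / 2) + lam * κ ^ 2 / 4 + lam * κ ^ 2 / 4 :=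
      calc lam * ‖a‖ ^ 2 ≤ _ := hb
        _ = ‖a‖ ^ 2 * (ρ ^ (2 * s - 2) * C₂ * τ ^ (2 - 2 * s)) +
            ρ ^ (2 * s - 2) * (2 * (lam * κ ^ 2 / (8 * ρ ^ (2 * s - 2)))) +
            2 * C₃ ^ 2 * C₄ * (ρ ^ (2 * s - 2) * ρ ^ (4 - 2 * s)) := by ring
        _ ≤ _ := by
          rw [h1, h2]
          gcongr
    refine le_of_sq_le_sq ?_ hκ.le
    have h4 : lam * ‖a‖ ^ 2 ≤ lam * κ ^ 2 := by linarith
    exact le_of_mul_le_mul_left h4 hlam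
  choose a ha ha' using hgrad
  have hP : 0 ≤ P := (norm_nonneg x).trans hx
  have hfinal := (convex_closedBall (0 : Euc n) P).norm_image_sub_le_of_norm_hasFDerivWithin_le
    (f := v) (f' := fun z => innerSL ℝ (a z)) (C := κ) (x := 0) (y := x)
    (fun z _ => (ha z).hasFDerivWithinAt)
    (fun z hz => by
      rw [innerSL_apply_norm]
      exact ha' z (mem_closedBall_zero_iff.1 hz))
    (by simpa using hP) (by simpa using hx)
  simpa [hv] using hfinal

lemma holder_of_hSemi_le_one {β : ℝ} (hβ0 : 0 < β) (hβ1 : β < 1) {u : Euc n → ℝ}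
    (h : hSemi β univ u ≤ 1) (x y : Euc n) : |u x - u y| ≤ ‖x - y‖ ^ β := by
  rcases eq_or_ne x y with rfl | hxy
  · simp [Real.zero_rpow hβ0.ne']
  have hdeg : hDeg β = 0 := by
    have : ⌈β⌉₊ ≤ 1 := Nat.ceil_le.2 (by simpa using hβ1.le)
    unfold hDeg
    omega
  have h1 := (le_iSup₂ (f := fun (x y : (univ : Set (Euc n))) =>
    ENNReal.ofReal (‖iteratedFDerivWithin ℝ (hDeg β) u univ ↑x -
      iteratedFDerivWithin ℝ (hDeg β) u univ ↑y‖ /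
        ‖(x : Euc n) - (y : Euc n)‖ ^ (β - (hDeg β : ℝ)))) ⟨x, mem_univ x⟩ ⟨y, mem_univ y⟩).trans h
  have hn : 0 < ‖x - y‖ := norm_pos_iff.2 (sub_ne_zero.2 hxy)
  rw [hdeg, ← ENNReal.ofReal_one, ENNReal.ofReal_le_ofReal_iff zero_le_one,
    Nat.cast_zero, sub_zero, div_le_one (by positivity), iteratedFDerivWithin_zero_eq_comp,
    Function.comp_apply, Function.comp_apply, ← map_sub, LinearIsometryEquiv.norm_map] at h1
  exact h1

lemma abs_sub_le_of_second_increment {U : Euc n → ℝ} {β κ : ℝ} {h : Euc n} (M : ℕ) (hM : 0 < M)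
    (hβ : 0 ≤ β) (hκ : 0 ≤ κ) (hh : ‖h‖ ≤ 1) (hU : ∀ x y, |U x - U y| ≤ ‖x - y‖ ^ β)
    (hinc : ∀ x, ‖x‖ ≤ M → |(U (x + h) - U x) - (U h - U 0)| ≤ κ * ‖x‖) :
    |U h - U 0| ≤ (M : ℝ) ^ (β - 1) + κ * M := by
  have hM' : (0 : ℝ) < M := by exact_mod_cast hM
  have hstep : ∀ j ≤ M, |(U ((j : ℝ) • h) - U 0) - j * (U h - U 0)| ≤ j * (κ * M) := by
    intro j
    induction j with
    | zero => intro _; simp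
    | succ j ih =>
      intro hj
      have hjM : (j : ℝ) ≤ M := by exact_mod_cast (Nat.le_succ j).trans hj
      have hn : ‖(j : ℝ) • h‖ ≤ M := by
        rw [norm_smul, Real.norm_natCast]
        exact (mul_le_of_le_one_right (Nat.cast_nonneg j) hh).trans hjM
      have h1 := ih ((Nat.le_succ j).trans hj)
      have h2 := (hinc _ hn).trans (mul_le_mul_of_nonneg_left hn hκ)
      push_cast
      rw [add_smul, one_smul]
      calc _ = |((U ((j : ℝ) • h) - U 0) - j * (U h - U 0)) +
            ((U ((j : ℝ) • h + h) - U ((j : ℝ) • h)) - (U h - U 0))| := by congr 1; ring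
        _ ≤ j * (κ * M) + κ * M := (abs_add_le _ _).trans (add_le_add h1 h2)
        _ = _ := by ring
  have h1 := hstep M le_rfl
  have h2 : |U ((M : ℝ) • h) - U 0| ≤ (M : ℝ) ^ β := by
    refine (hU _ _).trans (Real.rpow_le_rpow (norm_nonneg _) ?_ hβ)
    rw [sub_zero, norm_smul, Real.norm_natCast]
    exact mul_le_of_le_one_right (Nat.cast_nonneg M) hh
  have h3 : M * |U h - U 0| ≤ (M : ℝ) ^ β + M * (κ * M) := by
    have h4 := abs_sub_abs_le_abs_sub (M * (U h - U 0)) (U ((M : ℝ) • h) - U 0)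
    rw [abs_sub_comm (M * (U h - U 0)), abs_mul, abs_of_pos hM'] at h4
    linarith
  rw [Real.rpow_sub_one hM'.ne', ← mul_le_mul_iff_right₀ hM']
  refine h3.trans (le_of_eq ?_)
  field_simp

/-- **Quantitative Liouville-type estimate for divergence-form equations with small
oscillation** (Proposition 5.1). Under the `η ≤ δ` small-oscillation conditions on the
kernel, a weak solution `u` of `L(u,x) = f` in `B_{1/δ}` with `[u]_{C^β(ℝⁿ)} ≤ 1`, finite
`L^∞_{2s-ε}` norm and `‖f‖_{L^q(B_{1/δ})} ≤ δ` satisfies `‖u − u(0)‖_{L^∞(B₁)} ≤ ε₀`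
whenever `δ < δ₀(ε₀)`. -/
theorem stmt10 (n : ℕ) (s β q ε lam Lam : ℝ)
    (hs : s ∈ Set.Ioo (0 : ℝ) 1) (hβ : β ∈ Set.Ioo s (min 1 (2 * s)))
    (hq : 1 ≤ q) (hε : 0 < ε) (hlam : 0 < lam) (hlamLam : lam ≤ Lam) :
    ∀ ε₀ > (0 : ℝ), ∃ δ₀ > (0 : ℝ), ∀ δ : ℝ, 0 < δ → δ < δ₀ →
      ∀ (K : Euc n → Measure (Euc n)) (u f : Euc n → ℝ),
        MeasKernel K → DivSymmetric K → DivElliptic s lam Lam K →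
        (∃ η : ℝ, η ≤ δ ∧ XReg s 0 η K ∧ AlmostEven s 0 η K) →
        Continuous u →
        hSemi β Set.univ u ≤ 1 →
        supNormW (2 * s - ε) u ≠ ⊤ →
        eLpNorm f (ENNReal.ofReal q) (volume.restrict (ball 0 (1 / δ))) ≤ ENNReal.ofReal δ →
        WeakSol K u f (ball 0 (1 / δ)) →
        supNorm (ball 0 1) (fun x => u x - u 0) ≤ ENNReal.ofReal ε₀ := by
  intro ε₀ hε₀
  obtain ⟨hs0, hs1⟩ := hs
  obtain ⟨hβs, hβ⟩ := hβ
  obtain ⟨hβ1, hβ2⟩ := lt_min_iff.1 hβ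
  have hβ0 : 0 < β := hs0.trans hβs
  obtain ⟨r, hr0, hr1, hr⟩ := exists_mul_rpow_le (A := 2) hβ0 (show 0 < ε₀ / 3 by positivity)
    one_pos
  obtain ⟨φ, hφ⟩ := exists_isMollifier n hr0
  obtain ⟨M, hMβ, hM⟩ : ∃ M : ℕ, (M : ℝ) ^ (β - 1) ≤ ε₀ / 3 ∧ 0 < M := by
    have h := (tendsto_rpow_neg_atTop (y := 1 - β) (by linarith)).comp
      (tendsto_natCast_atTop_atTop (R := ℝ))
    simp only [neg_sub] at h
    exact ((h.eventually_le_const (show 0 < ε₀ / 3 by positivity)).and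
      (Filter.eventually_gt_atTop 0)).exists
  have hM' : (0 : ℝ) < M := by exact_mod_cast hM
  obtain ⟨δ₀, hδ₀, H⟩ := exists_second_increment_mollify_le hs0 hs1 hlam (hlam.le.trans hlamLam)
    hβ0 (by linarith) hβ2 hq hφ hr1 (κ := ε₀ / 3 / M) (by positivity) M
  refine ⟨δ₀, hδ₀, fun δ hδ hδ' K u f hK hsym hell hreg hu hsemi _ hf hw => ?_⟩
  obtain ⟨η, hη, hX, -⟩ := hreg
  have hH := holder_of_hSemi_le_one hβ0 hβ1 hsemi
  have D : IsAlmostSolution s β q lam Lam δ K u f :=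
    ⟨hK, hsym, hell, fun x ρ hρ => hX.tvDiff_le hη x hρ, hu, hH, hf, hw⟩
  refine iSup_le fun ⟨h, hh⟩ => ENNReal.ofReal_le_ofReal ?_
  have hh1 : ‖h‖ ≤ 1 := (mem_ball_zero_iff.1 hh).le
  have h1 := abs_sub_le_of_second_increment (U := mollify φ u) M hM hβ0.le (by positivity) hh1
    (hφ.abs_mollify_sub_le hu hH) fun x hx => H δ hδ hδ' K u f D h x hh1 hx
  rw [div_mul_cancel₀ _ hM'.ne'] at h1
  have h2 := abs_le.1 (hφ.abs_mollify_sub_self_le hβ0.le hu hH h)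
  have h3 := abs_le.1 (hφ.abs_mollify_sub_self_le hβ0.le hu hH 0)
  have h4 := abs_le.1 h1
  exact abs_le.2 ⟨by linarith, by linarith⟩

end
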